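/- Let p be a prime, s ≥ 1, and q = p^s. Let G be a primitive divergent graph, and suppose p² divides [Ψ_G]_p and q² divides [Ψ_G]_q. Then [Ψ_G]_q / q² ≡ (−1)^{s+1} ([Ψ_G]_p / p²)^s (mod p); that is, c₂^{(q)}(G) ≡ (−1)^{s+1} (c₂^{(p)}(G))^s (mod p). -/

import Mathlib

open MvPolynomial

/-- The number of points `x ∈ 𝔽_q^σ`, `q = p^s`, at which the integer polynomial `F`
vanishes (coefficients mapped into the field canonically). -/
noncomputable def pointCount {σ : Type} (p s : ℕ) [Fact p.Prime] (F : MvPolynomial σ ℤ) : ℕ :=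
  Nat.card {x : σ → GaloisField p s // MvPolynomial.aeval x F = 0}

-- The Kirchhoff polynomial `Ψ_G = ∑_T ∏_{e ∉ T} α_e`, the sum over spanning trees `T`
-- of `G`, a polynomial in variables indexed by the edges of `G`.
open Classical in
noncomputable def kirchhoff {V : Type} [Fintype V] [DecidableEq V]
    (G : SimpleGraph V) [DecidableRel G.Adj] : MvPolynomial ↥G.edgeFinset ℤ :=
  ∑ T ∈ G.edgeFinset.powerset.filter
      (fun T => (SimpleGraph.fromEdgeSet (T : Set (Sym2 V))).IsTree),
    ∏ e ∈ Finset.univ.filter (fun e : ↥G.edgeFinset => (e : Sym2 V) ∉ T), X e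

/-- A graph is internally 6-edge-connected if removing any set of at most 5 edges
results in at most one connected component containing an edge. -/
def InternallySixEdgeConnected {W : Type} (K : SimpleGraph W) : Prop :=
  ∀ S : Finset (Sym2 W), (S : Set (Sym2 W)) ⊆ K.edgeSet → S.card ≤ 5 →
    ∀ a b c d : W, (K.deleteEdges (S : Set (Sym2 W))).Adj a b →
      (K.deleteEdges (S : Set (Sym2 W))).Adj c d →
      (K.deleteEdges (S : Set (Sym2 W))).Reachable a c

/-- `G` is primitive divergent: `G` is connected and is the decompletion `K - v` of a
connected, 4-regular, internally 6-edge-connected simple graph `K` (here realized on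
vertex set `Option V` with deleted vertex `none`). -/
def IsPrimitiveDivergent {V : Type} [Fintype V] (G : SimpleGraph V) : Prop :=
  G.Connected ∧
  ∃ K : SimpleGraph (Option V),
    K.Connected ∧ (∀ w, (K.neighborSet w).ncard = 4) ∧
    InternallySixEdgeConnected K ∧
    ∀ a b : V, K.Adj (some a) (some b) ↔ G.Adj a b

section algpart
open Matrix

theorem det_schur {m n R : Type*} [CommRing R] [Fintype m] [DecidableEq m] [Fintype n]
    [DecidableEq n] (Q : Matrix m m R) (w : Matrix m n R) (z : Matrix n m R) (R0 : Matrix n n R) :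
    (fromBlocks Q w z R0).det * R0.det ^ Fintype.card m
      = (R0.det • Q - w * R0.adjugate * z).det * R0.det := by
  have h : fromBlocks Q w z R0 * fromBlocks (R0.det • (1 : Matrix m m R)) 0 (-(R0.adjugate * z)) 1
      = fromBlocks (R0.det • Q - w * R0.adjugate * z) w 0 R0 := by
    rw [fromBlocks_multiply]
    congr 1
    · simp [Matrix.mul_assoc, sub_eq_add_neg]
    · simp
    · rw [Matrix.mul_neg, ← Matrix.mul_assoc, mul_adjugate]; simp
    · simp
  have h2 := congrArg Matrix.det h
  rw [det_mul, det_fromBlocks_zero₂₁, det_fromBlocks_zero₁₂, det_smul] at h2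
  simpa using h2

/-- transfer of a bordered determinant from the regular case -/
theorem lift_charmatrix {n R : Type*} [CommRing R] [Fintype n] [DecidableEq n]
    (R0 : Matrix n n R) :
    (charmatrix (-R0)).map (Polynomial.evalRingHom (0 : R)) = R0 := by
  ext i j
  by_cases h : i = j
  · subst h; simp
  · simp [h]

def bform {n R : Type*} [CommRing R] [Fintype n] [DecidableEq n] (R0 : Matrix n n R)
    (a b : n → R) : R := -(a ⬝ᵥ (R0.adjugate *ᵥ b))

theorem bform_map {n R S : Type*} [CommRing R] [CommRing S] [Fintype n] [DecidableEq n]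
    (φ : R →+* S) (R0 : Matrix n n R) (a b : n → R) :
    φ (bform R0 a b) = bform (R0.map φ) (φ ∘ a) (φ ∘ b) := by
  unfold bform
  rw [map_neg]
  have := RingHom.map_adjugate φ R0
  simp only [RingHom.mapMatrix_apply] at this
  rw [← this]
  simp [dotProduct, mulVec, Matrix.map_apply]

def star4 {R : Type*} [CommRing R] (α ε : Fin 3 → R) : Matrix (Fin 3 ⊕ Unit) (Fin 3 ⊕ Unit) R :=
  fromBlocks (diagonal α) (of fun i _ => ε i) (of fun _ j => ε j) 0

def rows4 {n R : Type*} [CommRing R] (W : Fin 3 → n → R) : Matrix (Fin 3 ⊕ Unit) n R :=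
  of (Sum.elim W 0)

def starM {n R : Type*} [CommRing R] [Fintype n] [DecidableEq n] (R0 : Matrix n n R)
    (W : Fin 3 → n → R) (ε α : Fin 3 → R) : Matrix ((Fin 3 ⊕ Unit) ⊕ n) ((Fin 3 ⊕ Unit) ⊕ n) R :=
  fromBlocks (star4 α ε) (rows4 W) (rows4 W)ᵀ R0

theorem starM_map {n R S : Type*} [CommRing R] [CommRing S] [Fintype n] [DecidableEq n]
    (φ : R →+* S) (R0 : Matrix n n R) (W : Fin 3 → n → R) (ε α : Fin 3 → R) :
    φ (starM R0 W ε α).det = (starM (R0.map φ) (fun i => φ ∘ W i) (φ ∘ ε) (φ ∘ α)).det := by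
  rw [RingHom.map_det, RingHom.mapMatrix_apply]
  congr 1
  ext i j
  rcases i with (i | i) | i <;> rcases j with (j | j) | j <;>
    simp [starM, star4, rows4, Matrix.diagonal_apply, apply_ite φ]

theorem det4 {R : Type*} [CommRing R] (M : Matrix (Fin 3 ⊕ Unit) (Fin 3 ⊕ Unit) R) :
    M.det = (M.submatrix (![.inl 0, .inl 1, .inl 2, .inr ()] : Fin 4 → Fin 3 ⊕ Unit)
      ![.inl 0, .inl 1, .inl 2, .inr ()]).det := by
  let e : Fin 4 ≃ Fin 3 ⊕ Unit :=
    { toFun := ![.inl 0, .inl 1, .inl 2, .inr ()]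
      invFun := Sum.elim ![0, 1, 2] (fun _ => 3)
      left_inv := by intro i; fin_cases i <;> rfl
      right_inv := by rintro (i | i) <;> fin_cases i <;> rfl }
  exact (Matrix.det_submatrix_equiv_self e M).symm

theorem det_fin4 {R : Type*} [CommRing R] (a b c d a' b' c' d' x y z w x' y' z' w' : R) :
    (!![a, b, c, d; a', b', c', d'; x, y, z, w; x', y', z', w'] : Matrix (Fin 4) (Fin 4) R).det =
      a * (b' * (z * w' - w * z') - c' * (y * w' - w * y') + d' * (y * z' - z * y'))
      - b * (a' * (z * w' - w * z') - c' * (x * w' - w * x') + d' * (x * z' - z * x'))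
      + c * (a' * (y * w' - w * y') - b' * (x * w' - w * x') + d' * (x * y' - y * x'))
      - d * (a' * (y * z' - z * y') - b' * (x * z' - z * x') + c' * (x * y' - y * x')) := by
  rw [det_succ_row_zero]
  simp [Fin.sum_univ_succ, det_fin_three, Fin.succAbove]
  ring

theorem star_reg {n R : Type*} [CommRing R] [Fintype n] [DecidableEq n] (R0 : Matrix n n R)
    (hs : R0ᵀ = R0) (hreg : IsRegular R0.det) (W : Fin 3 → n → R) (ε α : Fin 3 → R)
    (hε : ∀ i, ε i * ε i = 1) :
    R0.det * (starM R0 W ε α).det =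
      -(R0.det ^ 2 * (α 0 * α 1 + α 0 * α 2 + α 1 * α 2)
        + R0.det * (α 0 * (bform R0 (ε 1 • W 1 - ε 0 • W 0) (ε 1 • W 1 - ε 0 • W 0)
              + bform R0 (ε 2 • W 2 - ε 0 • W 0) (ε 2 • W 2 - ε 0 • W 0)
              - 2 * bform R0 (ε 1 • W 1 - ε 0 • W 0) (ε 2 • W 2 - ε 0 • W 0))
          + α 1 * bform R0 (ε 2 • W 2 - ε 0 • W 0) (ε 2 • W 2 - ε 0 • W 0)
          + α 2 * bform R0 (ε 1 • W 1 - ε 0 • W 0) (ε 1 • W 1 - ε 0 • W 0))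
        + (bform R0 (ε 1 • W 1 - ε 0 • W 0) (ε 1 • W 1 - ε 0 • W 0)
            * bform R0 (ε 2 • W 2 - ε 0 • W 0) (ε 2 • W 2 - ε 0 • W 0)
           - bform R0 (ε 1 • W 1 - ε 0 • W 0) (ε 2 • W 2 - ε 0 • W 0) ^ 2)) := by
  have hsym : ∀ a b, a ⬝ᵥ (R0.adjugate *ᵥ b) = b ⬝ᵥ (R0.adjugate *ᵥ a) := by
    intro a b
    rw [dotProduct_mulVec, dotProduct_comm, ← mulVec_transpose, adjugate_transpose, hs]
  have h := det_schur (star4 α ε) (rows4 W) (rows4 W)ᵀ R0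
  change (starM R0 W ε α).det * _ = _ at h
  have hent : ∀ i j, (rows4 W * R0.adjugate * (rows4 W)ᵀ) i j
      = (Sum.elim W 0 i : n → R) ⬝ᵥ (R0.adjugate *ᵥ (Sum.elim W 0 j)) := by
    intro i j
    rw [Matrix.mul_assoc]
    rfl
  rw [det4] at h
  have hc : Fintype.card (Fin 3 ⊕ Unit) = 4 := by simp
  rw [hc] at h
  set d := R0.det with hd
  have hreg3 : IsRegular (d ^ 3) := hreg.pow 3
  apply hreg3.left
  dsimp only
  have e1 : d ^ 3 * (d * (starM R0 W ε α).det) = (starM R0 W ε α).det * d ^ 4 := by ring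
  have hM : ((d • star4 α ε - rows4 W * R0.adjugate * (rows4 W)ᵀ).submatrix
      (![.inl 0, .inl 1, .inl 2, .inr ()] : Fin 4 → Fin 3 ⊕ Unit)
      ![.inl 0, .inl 1, .inl 2, .inr ()]) =
      !![d * α 0 - W 0 ⬝ᵥ (R0.adjugate *ᵥ W 0), - W 0 ⬝ᵥ (R0.adjugate *ᵥ W 1),
          - W 0 ⬝ᵥ (R0.adjugate *ᵥ W 2), d * ε 0;
        - W 0 ⬝ᵥ (R0.adjugate *ᵥ W 1), d * α 1 - W 1 ⬝ᵥ (R0.adjugate *ᵥ W 1),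
          - W 1 ⬝ᵥ (R0.adjugate *ᵥ W 2), d * ε 1;
        - W 0 ⬝ᵥ (R0.adjugate *ᵥ W 2), - W 1 ⬝ᵥ (R0.adjugate *ᵥ W 2),
          d * α 2 - W 2 ⬝ᵥ (R0.adjugate *ᵥ W 2), d * ε 2;
        d * ε 0, d * ε 1, d * ε 2, 0] := by
    ext i j
    rw [submatrix_apply, Matrix.sub_apply, hent]
    fin_cases i <;> fin_cases j <;>
      simp [star4, hsym (W 1) (W 0), hsym (W 2) (W 0), hsym (W 2) (W 1)]
  rw [e1, h, hM, det_fin4]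
  have h0 := hε 0
  have h1 := hε 1
  have h2 := hε 2
  simp only [bform, mulVec_sub, mulVec_smul, dotProduct_sub, sub_dotProduct, smul_dotProduct,
    dotProduct_smul, smul_eq_mul]
  rw [hsym (W 1) (W 0), hsym (W 2) (W 0)]
  simp only [neg_dotProduct]
  generalize W 0 ⬝ᵥ (R0.adjugate *ᵥ W 0) = g00
  generalize W 0 ⬝ᵥ (R0.adjugate *ᵥ W 1) = g01
  generalize W 0 ⬝ᵥ (R0.adjugate *ᵥ W 2) = g02
  generalize W 1 ⬝ᵥ (R0.adjugate *ᵥ W 1) = g11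
  generalize W 1 ⬝ᵥ (R0.adjugate *ᵥ W 2) = g12
  generalize W 2 ⬝ᵥ (R0.adjugate *ᵥ W 2) = g22
  generalize ε 0 = e0 at *
  generalize ε 1 = e1 at *
  generalize ε 2 = e2 at *
  clear_value d
  have a0 : e0 ^ 2 = 1 := by rw [sq, h0]
  have a1 : e1 ^ 2 = 1 := by rw [sq, h1]
  have a2 : e2 ^ 2 = 1 := by rw [sq, h2]
  ring_nf
  simp only [a0, a1, a2]
  ring_nf

theorem charmatrix_symm {n R : Type*} [CommRing R] [Fintype n] [DecidableEq n]
    (R0 : Matrix n n R) (hs : R0ᵀ = R0) : (charmatrix (-R0))ᵀ = charmatrix (-R0) := by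
  rw [← charmatrix_transpose, transpose_neg, hs]

theorem charmatrix_det_reg {n R : Type*} [CommRing R] [Fintype n] [DecidableEq n]
    (R0 : Matrix n n R) : IsRegular (charmatrix (-R0)).det :=
  (Matrix.charpoly_monic (-R0)).isRegular

theorem ev_C {n R : Type*} [CommRing R] (v : n → R) :
    (Polynomial.evalRingHom (0 : R)) ∘ (fun i => Polynomial.C (v i)) = v := by
  ext; simp

theorem star_main {n R : Type*} [CommRing R] [Fintype n] [DecidableEq n] (R0 : Matrix n n R)
    (hs : R0ᵀ = R0) (W : Fin 3 → n → R) (ε : Fin 3 → R) (hε : ∀ i, ε i * ε i = 1) :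
    ∃ f : R, (∀ α : Fin 3 → R, (starM R0 W ε α).det =
      -(R0.det * (α 0 * α 1 + α 0 * α 2 + α 1 * α 2)
        + α 0 * (bform R0 (ε 1 • W 1 - ε 0 • W 0) (ε 1 • W 1 - ε 0 • W 0)
              + bform R0 (ε 2 • W 2 - ε 0 • W 0) (ε 2 • W 2 - ε 0 • W 0)
              - 2 * bform R0 (ε 1 • W 1 - ε 0 • W 0) (ε 2 • W 2 - ε 0 • W 0))
          + α 1 * bform R0 (ε 2 • W 2 - ε 0 • W 0) (ε 2 • W 2 - ε 0 • W 0)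
          + α 2 * bform R0 (ε 1 • W 1 - ε 0 • W 0) (ε 1 • W 1 - ε 0 • W 0)
        + f)) ∧ R0.det * f =
          (bform R0 (ε 1 • W 1 - ε 0 • W 0) (ε 1 • W 1 - ε 0 • W 0)
            * bform R0 (ε 2 • W 2 - ε 0 • W 0) (ε 2 • W 2 - ε 0 • W 0)
           - bform R0 (ε 1 • W 1 - ε 0 • W 0) (ε 2 • W 2 - ε 0 • W 0) ^ 2) := by
  let R1 := charmatrix (-R0)
  let W' : Fin 3 → n → Polynomial R := fun i j => Polynomial.C (W i j)
  let ε' : Fin 3 → Polynomial R := fun i => Polynomial.C (ε i)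
  have hε' : ∀ i, ε' i * ε' i = 1 := by
    intro i
    simp only [ε', ← map_mul, hε, map_one]
  have hreg : IsRegular R1.det := charmatrix_det_reg R0
  have hs1 : R1ᵀ = R1 := charmatrix_symm R0 hs
  have hR := lift_charmatrix R0
  have hdet : Polynomial.evalRingHom (0 : R) R1.det = R0.det := by
    rw [RingHom.map_det, RingHom.mapMatrix_apply, hR]
  have hb : ∀ i j, Polynomial.evalRingHom (0 : R)
      (bform R1 (ε' i • W' i - ε' 0 • W' 0) (ε' j • W' j - ε' 0 • W' 0))
      = bform R0 (ε i • W i - ε 0 • W 0) (ε j • W j - ε 0 • W 0) := by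
    intro i j
    rw [bform_map, hR]
    congr 1 <;> · ext k; simp [W', ε']
  have hst : ∀ α : Fin 3 → R, Polynomial.evalRingHom (0 : R)
      (starM R1 W' ε' (fun i => Polynomial.C (α i))).det = (starM R0 W ε α).det := by
    intro α
    rw [starM_map, hR]
    congr 1
    congr 1
    · ext; simp [W']
    · ext; simp [ε']
    · ext; simp
  have h0 := star_reg R1 hs1 hreg W' ε' (fun i => Polynomial.C ((0 : Fin 3 → R) i)) hε'
  refine ⟨-(starM R0 W ε 0).det, ?_, ?_⟩
  · intro α
    have h1 := star_reg R1 hs1 hreg W' ε' (fun i => Polynomial.C (α i)) hε'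
    have h2 : (starM R1 W' ε' (fun i => Polynomial.C (α i))).det
        = -(R1.det * (Polynomial.C (α 0) * Polynomial.C (α 1) + Polynomial.C (α 0) * Polynomial.C (α 2) + Polynomial.C (α 1) * Polynomial.C (α 2))
        + Polynomial.C (α 0) * (bform R1 (ε' 1 • W' 1 - ε' 0 • W' 0) (ε' 1 • W' 1 - ε' 0 • W' 0)
              + bform R1 (ε' 2 • W' 2 - ε' 0 • W' 0) (ε' 2 • W' 2 - ε' 0 • W' 0)
              - 2 * bform R1 (ε' 1 • W' 1 - ε' 0 • W' 0) (ε' 2 • W' 2 - ε' 0 • W' 0))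
          + Polynomial.C (α 1) * bform R1 (ε' 2 • W' 2 - ε' 0 • W' 0) (ε' 2 • W' 2 - ε' 0 • W' 0)
          + Polynomial.C (α 2) * bform R1 (ε' 1 • W' 1 - ε' 0 • W' 0) (ε' 1 • W' 1 - ε' 0 • W' 0)
        - (starM R1 W' ε' (fun i => Polynomial.C ((0 : Fin 3 → R) i))).det) := by
      apply hreg.left
      dsimp only
      simp only [Pi.zero_apply, map_zero] at h0 ⊢
      linear_combination h1 - h0
    have h3 := congrArg (Polynomial.evalRingHom (0 : R)) h2
    simp only [map_neg, map_add, map_sub, map_mul, map_ofNat, hb, hdet, hst] at h3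
    rw [h3]
    simp
    ring
  · have h3 := congrArg (Polynomial.evalRingHom (0 : R)) h0
    rw [map_mul, hst, hdet] at h3
    simp only [map_neg, map_add, map_sub, map_mul, map_ofNat, hb, hdet, hst, Pi.zero_apply,
      map_zero, map_pow] at h3
    rw [mul_neg, h3]
    ring

/-- one-row border -/
def bord {n R : Type*} [CommRing R] (R0 : Matrix n n R)
    (a b : n → R) (t : R) : Matrix (Unit ⊕ n) (Unit ⊕ n) R :=
  fromBlocks (of fun _ _ => t) (of fun _ j => a j) (of fun i _ => b i) R0

theorem bord_det {n R : Type*} [CommRing R] [Fintype n] [DecidableEq n] (R0 : Matrix n n R)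
    (a b : n → R) (t : R) : (bord R0 a b t).det = R0.det * t + bform R0 a b := by
  let R1 := charmatrix (-R0)
  have hreg : IsRegular R1.det := charmatrix_det_reg R0
  have hR := lift_charmatrix R0
  have hdet : Polynomial.evalRingHom (0 : R) R1.det = R0.det := by
    rw [RingHom.map_det, RingHom.mapMatrix_apply, hR]
  have h2 : (bord R1 (fun i => Polynomial.C (a i)) (fun i => Polynomial.C (b i)) (Polynomial.C t)).det
    = R1.det * Polynomial.C t + bform R1 (fun i => Polynomial.C (a i)) (fun i => Polynomial.C (b i)) := by
    apply hreg.right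
    have := det_schur (of fun (_ _ : Unit) => Polynomial.C t)
      (of fun (_ : Unit) j => Polynomial.C (a j)) (of fun i (_ : Unit) => Polynomial.C (b i)) R1
    simp only [Fintype.card_unit, pow_one] at this
    dsimp only
    rw [bord, this]
    congr 1
    rw [det_unique]
    simp only [bform, Matrix.sub_apply, Matrix.mul_assoc, Matrix.smul_apply, of_apply, smul_eq_mul,
      sub_eq_add_neg]
    rfl
  have h3 := congrArg (Polynomial.evalRingHom (0 : R)) h2
  rw [map_add, map_mul, hdet, bform_map, hR, RingHom.map_det, RingHom.mapMatrix_apply,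
    ev_C, ev_C] at h3
  rw [show Polynomial.evalRingHom (0:R) (Polynomial.C t) = t by simp] at h3
  rw [← h3]
  congr 1
  ext i j
  rcases i with i | i <;> rcases j with j | j <;> simp [bord]
  have := congrFun (congrFun hR i) j
  simpa using this.symm
end algpart

section cntpart
open Matrix

open Classical in
noncomputable def cnt {α : Type} [Fintype α] (P : α → Prop) : ℤ := ∑ x, if P x then 1 else 0

theorem cnt_congr {α : Type} [Fintype α] {P Q : α → Prop} (h : ∀ x, P x ↔ Q x) :
    cnt P = cnt Q := by
  have : P = Q := funext fun x => propext (h x)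
  rw [this]

theorem cnt_equiv {α β : Type} [Fintype α] [Fintype β] (e : α ≃ β) (P : β → Prop) :
    cnt (fun a => P (e a)) = cnt P := by
  classical
  unfold cnt
  convert Equiv.sum_comp e (fun x => if P x then (1 : ℤ) else 0)

theorem cnt_prod {α β : Type} [Fintype α] [Fintype β] (P : α × β → Prop) :
    cnt P = ∑ b, cnt (fun a => P (a, b)) := by
  unfold cnt
  rw [Fintype.sum_prod_type_right]

theorem cnt_or {α : Type} [Fintype α] (P Q : α → Prop) :
    cnt (fun x => P x ∨ Q x) = cnt P + cnt Q - cnt (fun x => P x ∧ Q x) := by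
  unfold cnt
  rw [← Finset.sum_add_distrib, ← Finset.sum_sub_distrib]
  refine Finset.sum_congr rfl fun x _ => ?_
  by_cases h1 : P x <;> by_cases h2 : Q x <;> simp [h1, h2]

theorem cnt_true {α : Type} [Fintype α] (P : α → Prop) (h : ∀ x, P x) :
    cnt P = Fintype.card α := by
  unfold cnt; simp [h]

theorem cnt_false {α : Type} [Fintype α] (P : α → Prop) (h : ∀ x, ¬ P x) :
    cnt P = 0 := by
  unfold cnt; simp [h]

theorem cnt_unique {α : Type} [Fintype α] (P : α → Prop) (a : α) (h : ∀ x, P x ↔ x = a) :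
    cnt P = 1 := by
  classical
  unfold cnt; simp [h]

theorem cnt_card {α : Type} [Fintype α] (P : α → Prop) :
    cnt P = (Nat.card {x // P x} : ℤ) := by
  classical
  unfold cnt
  rw [Nat.card_eq_fintype_card, Fintype.card_subtype]
  simp

open Classical in
theorem cnt_lin {K : Type} [Field K] [Fintype K] (A B : K) :
    cnt (fun a : K => A * a + B = 0)
      = if A ≠ 0 then 1 else if B = 0 then (Fintype.card K : ℤ) else 0 := by
  by_cases hA : A = 0
  · by_cases hB : B = 0
    · simp only [hA, hB]; rw [cnt_true] <;> simp
    · simp only [hA, hB]; rw [cnt_false] <;> simp [hB]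
  · simp only [ne_eq, hA, not_false_eq_true, if_true]
    apply cnt_unique _ (-B / A)
    intro x
    rw [eq_div_iff hA, mul_comm x A]
    exact add_eq_zero_iff_eq_neg

theorem cnt_lin' {K : Type} [Field K] [Fintype K] (A B : K) (hA : A ≠ 0) :
    cnt (fun a : K => A * a + B = 0) = 1 := by rw [cnt_lin]; simp [hA]

theorem inner_count_prod {K : Type} [Field K] [Fintype K] (f0 g1 g2 g3 f : K)
    (h : f0 * f = g1 * g2 - g3 ^ 2) (P : K × (K × K) → Prop)
    (hP : ∀ a b c, P (a, (b, c)) ↔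
      f0 * (a * b + a * c + b * c) + a * (g1 + g2 - 2 * g3) + b * g2 + c * g1 + f = 0) :
    (¬ (f0 = 0 ∧ g1 = 0 ∧ g2 = 0) → cnt P = (Fintype.card K : ℤ) ^ 2) ∧
    (f0 = 0 → g1 = 0 → g2 = 0 → f = 0 → cnt P = (Fintype.card K : ℤ) ^ 3) ∧
    (f0 = 0 → g1 = 0 → g2 = 0 → f ≠ 0 → cnt P = 0) := by
  classical
  set q : ℤ := (Fintype.card K : ℤ) with hq
  refine ⟨fun hne => ?_, ?_, ?_⟩
  · by_cases hf0 : f0 = 0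
    · subst hf0
      by_cases hc : g1 + g2 - 2 * g3 = 0
      · have h1 : g1 = g3 := by
          have : (g1 - g3) ^ 2 = 0 := by linear_combination g1 * hc + h
          exact sub_eq_zero.mp (pow_eq_zero_iff two_ne_zero |>.mp this)
        have h2 : g2 = g1 := by linear_combination hc - 2 * h1
        have hg : g1 ≠ 0 := fun h0 => hne ⟨rfl, h0, by rw [h2, h0]⟩
        subst h2
        rw [cnt_prod, Fintype.sum_prod_type]
        have : ∀ x y : K, cnt (fun a => P (a, (x, y))) = q * (if g2 * y + (x * g2 + f) = 0 then 1 else 0) := by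
          intro x y
          rw [cnt_congr (Q := fun a => (0 : K) * a + (g2 * y + (x * g2 + f)) = 0), cnt_lin]
          · simp [← hq]
          · intro a; rw [hP, ← h1]; ring_nf
        simp only [this, ← Finset.mul_sum]
        have h3 : ∀ x : K, ∑ y : K, (if g2 * y + (x * g2 + f) = 0 then (1 : ℤ) else 0) = 1 := by
          intro x
          have := cnt_lin' g2 (x * g2 + f) hg
          unfold cnt at this
          exact this
        simp [h3, ← hq]; ring
      · rw [cnt_prod]
        have : ∀ x : K × K, cnt (fun a => P (a, x)) = 1 := by
          rintro ⟨x, y⟩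
          rw [← cnt_lin' _ (x * g2 + y * g1 + f) hc]
          apply cnt_congr
          intro a; rw [hP]; ring_nf
        simp [this, ← hq]; ring
    · rw [cnt_prod, Fintype.sum_prod_type]
      have : ∀ x y : K, cnt (fun a => P (a, (x, y))) =
         1 + (if f0 * y + (f0 * x + (g1 + g2 - 2 * g3)) = 0 then
          ((if f0 * x + (g1 - g3) = 0 then q else 0) - 1) else 0) := by
        intro x y
        rw [cnt_congr (Q := fun a => (f0 * y + (f0 * x + (g1 + g2 - 2 * g3))) * a
          + (f0 * x * y + x * g2 + y * g1 + f) = 0), cnt_lin]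
        · by_cases h0 : f0 * y + (f0 * x + (g1 + g2 - 2 * g3)) = 0
          · simp only [h0, ne_eq, not_true, if_false, if_true, ← hq]
            have : f0 * x * y + x * g2 + y * g1 + f = 0 ↔ f0 * x + (g1 - g3) = 0 := by
              rw [← pow_eq_zero_iff (a := f0 * x + (g1 - g3)) two_ne_zero]
              have e : (f0 * x + (g1 - g3)) ^ 2 = -(f0 * (f0 * x * y + x * g2 + y * g1 + f)) := by
                linear_combination (f0 * x + g1) * h0 + h
              rw [e, neg_eq_zero, mul_eq_zero, or_iff_right hf0]
            simp only [this]
            ring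
          · simp [h0]
        · intro a; rw [hP]; ring_nf
      simp only [this, Finset.sum_add_distrib]
      have h3 : ∀ (x : K) (z : ℤ), ∑ y : K, (if f0 * y + (f0 * x + (g1 + g2 - 2 * g3)) = 0 then z else 0) = z := by
        intro x z
        have := cnt_lin' f0 (f0 * x + (g1 + g2 - 2 * g3)) hf0
        unfold cnt at this
        have h4 := congrArg (z * ·) this
        simpa only [Finset.mul_sum, mul_ite, mul_one, mul_zero] using h4
      have h4 : ∑ y : K, (if f0 * y + (g1 - g3) = 0 then q else 0) = q := by
        have := cnt_lin' f0 (g1 - g3) hf0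
        unfold cnt at this
        have h4 := congrArg (q * ·) this
        simpa only [Finset.mul_sum, mul_ite, mul_one, mul_zero] using h4
      simp only [h3, Finset.sum_sub_distrib, h4]
      simp [← hq]; ring
  · rintro rfl rfl rfl rfl
    rw [cnt_true]
    · simp [← hq]; ring
    · rintro ⟨a, b, c⟩; rw [hP]
      have : g3 = 0 := by
        have : g3 ^ 2 = 0 := by linear_combination h
        exact pow_eq_zero_iff two_ne_zero |>.mp this
      rw [this]; ring
  · rintro rfl rfl rfl hf
    rw [cnt_false]
    rintro ⟨a, b, c⟩; rw [hP]
    have : g3 = 0 := by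
      have : g3 ^ 2 = 0 := by linear_combination h
      exact pow_eq_zero_iff two_ne_zero |>.mp this
    rw [this]
    intro h; apply hf; linear_combination h
end cntpart

section starpart
open Matrix

def bmat {E U R : Type} [CommRing R] [DecidableEq E] (B : Matrix E U R)
    (x : E → R) : Matrix (E ⊕ U) (E ⊕ U) R := fromBlocks (diagonal x) B Bᵀ 0

theorem bmat_symm {E U R : Type} [CommRing R] [DecidableEq E] (B : Matrix E U R)
    (x : E → R) : (bmat B x)ᵀ = bmat B x := by
  simp [bmat, fromBlocks_transpose]

theorem bmat_map {E U R S : Type} [CommRing R] [CommRing S] [DecidableEq E] (φ : R →+* S)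
    (B : Matrix E U R)
    (x : E → R) : (bmat B x).map φ = bmat (B.map φ) (φ ∘ x) := by
  ext i j
  rcases i with i | i <;> rcases j with j | j <;> simp [bmat, diagonal_apply, apply_ite φ]

theorem bmat_reindex {E U E2 U2 R : Type} [CommRing R] [DecidableEq E] [Fintype E] [DecidableEq U]
    [Fintype U] [DecidableEq E2] [Fintype E2] [DecidableEq U2]
    [Fintype U2] (e : E ≃ E2) (u : U ≃ U2) (B : Matrix E2 U2 R) (x : E2 → R) :
    (bmat (B.submatrix e u) (x ∘ e)).det = (bmat B x).det := by
  rw [← det_submatrix_equiv_self (Equiv.sumCongr e u)]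
  congr 1
  ext i j
  rcases i with i | i <;> rcases j with j | j <;> simp [bmat, diagonal_apply]

theorem cnt_bmat_reindex {E U E2 U2 K : Type} [Field K] [Fintype K] [DecidableEq E] [Fintype E] [DecidableEq U]
    [Fintype U] [DecidableEq E2] [Fintype E2] [DecidableEq U2]
    [Fintype U2] (e : E ≃ E2) (u : U ≃ U2) (B : Matrix E2 U2 K) :
    cnt (fun x => (bmat (B.submatrix e u) x).det = 0) = cnt (fun x => (bmat B x).det = 0) := by
  rw [← cnt_equiv (Equiv.arrowCongr e.symm (Equiv.refl K))]
  apply cnt_congr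
  intro x
  rw [← bmat_reindex e u B x]
  rfl

/-- the row vector of a star edge -/
def sW {E U R : Type} [CommRing R] (B : Matrix (Fin 3 ⊕ E) (Unit ⊕ U) R) (i : Fin 3) : E ⊕ U → R :=
  Sum.elim 0 (fun u => B (.inl i) (.inr u))

def sE {E U R : Type} (B : Matrix (Fin 3 ⊕ E) (Unit ⊕ U) R) (i : Fin 3) : R :=
  B (.inl i) (.inl ())

def sw {E U R : Type} [CommRing R] (B : Matrix (Fin 3 ⊕ E) (Unit ⊕ U) R) (i : Fin 3) : E ⊕ U → R :=
  sE B i • sW B i - sE B 0 • sW B 0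

def sB {E U R : Type} (B : Matrix (Fin 3 ⊕ E) (Unit ⊕ U) R) : Matrix E U R :=
  B.submatrix .inr .inr

theorem bmat_starM {E U R : Type} [CommRing R] [DecidableEq E] [Fintype E] [DecidableEq U]
    [Fintype U] (B : Matrix (Fin 3 ⊕ E) (Unit ⊕ U) R) (hB : ∀ e, B (.inr e) (.inl ()) = 0)
    (α : Fin 3 → R) (x : E → R) :
    (bmat B (Sum.elim α x)).det = (starM (bmat (sB B) x) (sW B) (sE B) α).det := by
  rw [← det_submatrix_equiv_self (Equiv.sumSumSumComm (Fin 3) E Unit U).symm]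
  congr 1
  ext i j
  rcases i with (i | i) | i | i <;> rcases j with (j | j) | j | j <;>
    simp [bmat, starM, star4, rows4, sW, sE, sB, diagonal_apply, hB]

open Classical in
theorem star_count {E U K : Type} [Field K] [Fintype K] [DecidableEq E] [Fintype E] [DecidableEq U]
    [Fintype U] (B : Matrix (Fin 3 ⊕ E) (Unit ⊕ U) K) (hB : ∀ e, B (.inr e) (.inl ()) = 0)
    (hε : ∀ i, sE B i * sE B i = 1) :
    ∃ Z' : ℤ, cnt (fun x => (bmat B x).det = 0)
      = (Fintype.card K : ℤ) ^ 2 * ((Fintype.card K : ℤ) ^ Fintype.card E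
          - cnt (fun x : E → K => (bmat (sB B) x).det = 0 ∧ bform (bmat (sB B) x) (sw B 1) (sw B 1) = 0
            ∧ bform (bmat (sB B) x) (sw B 2) (sw B 2) = 0)) + (Fintype.card K : ℤ) ^ 3 * Z' := by
  have key : ∀ x : E → K, ∃ z : ℤ, cnt (fun α : Fin 3 → K => (bmat B (Sum.elim α x)).det = 0)
      = (Fintype.card K : ℤ) ^ 2 * (1 - if (bmat (sB B) x).det = 0 ∧ bform (bmat (sB B) x) (sw B 1) (sw B 1) = 0
            ∧ bform (bmat (sB B) x) (sw B 2) (sw B 2) = 0 then 1 else 0) + (Fintype.card K : ℤ) ^ 3 * z := by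
    intro x
    obtain ⟨f, h1, h2⟩ := star_main (bmat (sB B) x) (bmat_symm _ _) (sW B) (sE B) hε
    let e3 : K × (K × K) ≃ (Fin 3 → K) :=
      { toFun := fun a => ![a.1, a.2.1, a.2.2]
        invFun := fun a => (a 0, (a 1, a 2))
        left_inv := fun a => rfl
        right_inv := fun a => by ext i; fin_cases i <;> rfl }
    rw [← cnt_equiv e3]
    obtain ⟨k1, k2, k3⟩ := inner_count_prod _ _ _ _ f h2
      (fun a => (bmat B (Sum.elim (e3 a) x)).det = 0) (by
        intro a b c
        rw [bmat_starM B hB, h1, neg_eq_zero]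
        rfl)
    by_cases hc : (bmat (sB B) x).det = 0 ∧ bform (bmat (sB B) x) (sw B 1) (sw B 1) = 0
            ∧ bform (bmat (sB B) x) (sw B 2) (sw B 2) = 0
    · rw [if_pos hc]
      by_cases hf : f = 0
      · exact ⟨1, by rw [k2 hc.1 hc.2.1 hc.2.2 hf]; ring⟩
      · exact ⟨0, by rw [k3 hc.1 hc.2.1 hc.2.2 hf]; ring⟩
    · rw [if_neg hc]
      exact ⟨0, by rw [k1 hc]; ring⟩
  choose z hz using key
  refine ⟨∑ x, z x, ?_⟩
  rw [← cnt_equiv (Equiv.sumArrowEquivProdArrow (Fin 3) E K).symm, cnt_prod]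
  have : ∀ x : E → K, cnt (fun a : Fin 3 → K => (bmat B ((Equiv.sumArrowEquivProdArrow (Fin 3) E K).symm (a, x))).det = 0)
     = cnt (fun α : Fin 3 → K => (bmat B (Sum.elim α x)).det = 0) := fun x => rfl
  simp only [this, hz]
  rw [Finset.sum_add_distrib, ← Finset.mul_sum, ← Finset.mul_sum, Finset.sum_sub_distrib]
  congr 3
  · simp
  · unfold cnt; exact Finset.sum_congr rfl fun x _ => by congr

theorem star_sq {E U K : Type} [Field K] [DecidableEq E] [Fintype E] [DecidableEq U]
    [Fintype U] (B : Matrix (Fin 3 ⊕ E) (Unit ⊕ U) K)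
    (hε : ∀ i, sE B i * sE B i = 1) (x : E → K) (h0 : (bmat (sB B) x).det = 0) :
    bform (bmat (sB B) x) (sw B 1) (sw B 1) * bform (bmat (sB B) x) (sw B 2) (sw B 2)
      = bform (bmat (sB B) x) (sw B 1) (sw B 2) ^ 2 := by
  obtain ⟨f, h1, h2⟩ := star_main (bmat (sB B) x) (bmat_symm _ _) (sW B) (sE B) hε
  rw [h0, zero_mul] at h2
  exact (sub_eq_zero.mp h2.symm)

theorem star_ie {E U K : Type} [Field K] [Fintype K] [DecidableEq E] [Fintype E] [DecidableEq U]
    [Fintype U] (B : Matrix (Fin 3 ⊕ E) (Unit ⊕ U) K)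
    (hε : ∀ i, sE B i * sE B i = 1) :
    cnt (fun x : E → K => (bmat (sB B) x).det = 0 ∧ bform (bmat (sB B) x) (sw B 1) (sw B 2) = 0)
    = cnt (fun x : E → K => (bmat (sB B) x).det = 0 ∧ bform (bmat (sB B) x) (sw B 1) (sw B 1) = 0)
    + cnt (fun x : E → K => (bmat (sB B) x).det = 0 ∧ bform (bmat (sB B) x) (sw B 2) (sw B 2) = 0)
    - cnt (fun x : E → K => (bmat (sB B) x).det = 0 ∧ bform (bmat (sB B) x) (sw B 1) (sw B 1) = 0
            ∧ bform (bmat (sB B) x) (sw B 2) (sw B 2) = 0) := by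
  rw [cnt_congr (Q := fun x => ((bmat (sB B) x).det = 0 ∧ bform (bmat (sB B) x) (sw B 1) (sw B 1) = 0)
    ∨ ((bmat (sB B) x).det = 0 ∧ bform (bmat (sB B) x) (sw B 2) (sw B 2) = 0)), cnt_or]
  · congr 1
    apply cnt_congr
    intro x; tauto
  · intro x
    by_cases h : (bmat (sB B) x).det = 0
    · have := star_sq B hε x h
      simp only [h, true_and]
      rw [← mul_eq_zero, this, pow_eq_zero_iff two_ne_zero]
    · simp [h]

theorem star_dvd {E U K : Type} [Field K] [Fintype K] [DecidableEq E] [Fintype E] [DecidableEq U]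
    [Fintype U] (B : Matrix (Fin 3 ⊕ E) (Unit ⊕ U) K) (hB : ∀ e, B (.inr e) (.inl ()) = 0)
    (hε : ∀ i, sE B i * sE B i = 1) :
    (Fintype.card K : ℤ) ^ 2 ∣ cnt (fun x => (bmat B x).det = 0) := by
  obtain ⟨Z, hZ⟩ := star_count B hB hε
  rw [hZ, pow_succ _ 2, mul_assoc, ← mul_add]
  exact dvd_mul_right _ _
end starpart

section degpart
open Matrix

theorem det_deg {E U σ R : Type} [CommRing R] [DecidableEq E] [Fintype E] [DecidableEq U]
    [Fintype U] (D : E → MvPolynomial σ R) (hD : ∀ e, (D e).totalDegree ≤ 1)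
    (A : Matrix E U R) (A2 : Matrix U E R) (hc : Fintype.card U ≤ Fintype.card E) :
    (fromBlocks (diagonal D) (A.map C) (A2.map C) 0).det.totalDegree
      ≤ Fintype.card E - Fintype.card U := by
  rw [det_apply]
  refine (totalDegree_finsetSum _ _).trans (Finset.sup_le fun π _ => ?_)
  set M := fromBlocks (diagonal D) (A.map (C (σ := σ))) (A2.map C) 0 with hM
  have h1 : (Equiv.Perm.sign π • ∏ i, M (π i) i).totalDegree ≤ (∏ i, M (π i) i).totalDegree := by
    rcases Int.units_eq_one_or (Equiv.Perm.sign π) with h | h <;> rw [h]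
    · simp
    · rw [Units.neg_smul, one_smul, totalDegree_neg]
  refine h1.trans ?_
  by_cases hz : ∃ i, M (π i) i = 0
  · obtain ⟨i, hi⟩ := hz
    rw [Finset.prod_eq_zero (f := fun i => M (π i) i) (Finset.mem_univ i) hi]; simp
  push Not at hz
  refine (totalDegree_finsetProd _ _).trans ?_
  let r : E ⊕ U → ℤ := Sum.elim (fun _ => 1) (fun _ => 0)
  let c : E ⊕ U → ℤ := Sum.elim (fun _ => 0) (fun _ => -1)
  have key : ∀ i j, M i j ≠ 0 → ((M i j).totalDegree : ℤ) ≤ r i + c j := by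
    rintro (i | i) (j | j) h
    · simp only [hM, fromBlocks_apply₁₁, diagonal_apply, r, c, Sum.elim_inl]
      split_ifs
      · exact_mod_cast hD i
      · simp
    · simp [hM, r, c]
    · simp [hM, r, c]
    · simp [hM] at h
  have h2 : ((∑ i, (M (π i) i).totalDegree : ℕ) : ℤ) ≤ Fintype.card E - Fintype.card U := by
    push_cast
    calc _ ≤ ∑ i, (r (π i) + c i) := Finset.sum_le_sum fun i _ => key _ _ (hz i)
      _ = ∑ i, r i + ∑ i, c i := by rw [Finset.sum_add_distrib, Equiv.sum_comp π]
      _ = _ := by simp [r, c, Fintype.sum_sum_type]; ring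
  omega

noncomputable def pf {E U R : Type} [CommRing R] [DecidableEq E] [Fintype E] [DecidableEq U]
    [Fintype U] (B : Matrix E U R) : MvPolynomial E R := (bmat (B.map C) X).det

noncomputable def pg {E U R : Type} [CommRing R] [DecidableEq E] [Fintype E] [DecidableEq U]
    [Fintype U] (B : Matrix E U R) (a b : E ⊕ U → R) : MvPolynomial E R :=
  bform (bmat (B.map C) X) (C ∘ a) (C ∘ b)

theorem totalDegree_X_le {E R : Type} [CommRing R] (e : E) : (X e : MvPolynomial E R).totalDegree ≤ 1 := by
  rcases subsingleton_or_nontrivial R with h | h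
  · rw [Subsingleton.elim (X e : MvPolynomial E R) 0]; simp
  · simp

theorem pf_deg {E U R : Type} [CommRing R] [DecidableEq E] [Fintype E] [DecidableEq U]
    [Fintype U] (B : Matrix E U R) (hc : Fintype.card U ≤ Fintype.card E) :
    (pf B).totalDegree ≤ Fintype.card E - Fintype.card U := by
  exact det_deg X totalDegree_X_le B Bᵀ hc

theorem pg_deg {E U R : Type} [CommRing R] [DecidableEq E] [Fintype E] [DecidableEq U]
    [Fintype U] (B : Matrix E U R) (a b : E ⊕ U → R) (ha : ∀ e, a (.inl e) = 0)
    (hb : ∀ e, b (.inl e) = 0) (hc : Fintype.card U ≤ Fintype.card E + 1) :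
    (pg B a b).totalDegree ≤ Fintype.card E + 1 - Fintype.card U := by
  have h := bord_det (bmat (B.map (C (σ := E))) X) (C ∘ a) (C ∘ b) 0
  rw [mul_zero, zero_add] at h
  rw [pg, ← h, ← det_submatrix_equiv_self (Equiv.sumAssoc Unit E U)]
  have := det_deg (E := Unit ⊕ E) (Sum.elim (fun _ => 0) (X (R := R))) (by
      rintro (e | e)
      · simp
      · exact totalDegree_X_le e)
    (of (Sum.elim (fun _ u => a (.inr u)) B)) (of fun u => (Sum.elim (fun _ => b (.inr u)) (fun e => B e u)))
    (by simp; omega)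
  refine le_trans (le_of_eq ?_) (this.trans (by simp; omega))
  congr 2
  ext1 i j
  rcases i with (i | i) | i <;> rcases j with (j | j) | j <;>
    simp [bord, bmat, diagonal_apply, ha, hb]
  all_goals rfl

theorem pf_aeval {E U R K : Type} [CommRing R] [CommRing K] [Algebra R K] [DecidableEq E] [Fintype E] [DecidableEq U]
    [Fintype U] (B : Matrix E U R) (x : E → K) :
    aeval x (pf B) = (bmat (B.map (algebraMap R K)) x).det := by
  have := RingHom.map_det (aeval (R := R) x).toRingHom (bmat (B.map C) X)
  rw [RingHom.mapMatrix_apply, bmat_map] at this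
  refine this.trans ?_
  congr 2
  · ext i j; simp
  · ext i; simp

theorem pg_aeval {E U R K : Type} [CommRing R] [CommRing K] [Algebra R K] [DecidableEq E] [Fintype E] [DecidableEq U]
    [Fintype U] (B : Matrix E U R) (a b : E ⊕ U → R) (x : E → K) :
    aeval x (pg B a b) = bform (bmat (B.map (algebraMap R K)) x) (algebraMap R K ∘ a) (algebraMap R K ∘ b) := by
  have := bform_map (aeval (R := R) x).toRingHom (bmat (B.map C) X) (C ∘ a) (C ∘ b)
  rw [bmat_map] at this
  refine this.trans ?_
  have e1 : (B.map C).map (aeval (R := R) x).toRingHom = B.map (algebraMap R K) := by ext i j; simp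
  have e2 : (aeval (R := R) x).toRingHom ∘ X = x := by ext i; simp
  have e3 : ∀ a : E ⊕ U → R, (aeval (R := R) x).toRingHom ∘ C ∘ a = algebraMap R K ∘ a := by intro a; ext i; simp
  rw [e1, e2, e3, e3]

theorem cw {E K : Type} [Field K] [Fintype K] [Fintype E] [DecidableEq E] (p : ℕ) [CharP K p]
    (f : MvPolynomial E K) (h : f.totalDegree < Fintype.card E) :
    (p : ℤ) ∣ cnt (fun x => eval x f = 0) := by
  classical
  have := char_dvd_card_solutions p h
  rw [cnt_card, Nat.card_eq_fintype_card]
  exact_mod_cast this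

theorem cw_bmat {E U K : Type} [Field K] [Fintype K] [Fintype E] [DecidableEq E]
    [Fintype U] [DecidableEq U] (p : ℕ) [CharP K p] (B : Matrix E U K)
    (h0 : 0 < Fintype.card U) (h1 : Fintype.card U ≤ Fintype.card E) :
    (p : ℤ) ∣ cnt (fun x => (bmat B x).det = 0) := by
  have := cw p (pf B) (lt_of_le_of_lt (pf_deg B h1) (by omega))
  rw [cnt_congr] at this
  · exact this
  · intro x
    rw [← MvPolynomial.coe_aeval_eq_eval]
    have h := pf_aeval (K := K) B x
    simp only [Algebra.algebraMap_self] at h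
    erw [h]
    simp
end degpart

section vanpart
open Matrix

noncomputable def splitEq {ι E : Type} (i : ι → E) (hi : Function.Injective i) :
    ι ⊕ {e // e ∉ Set.range i} ≃ E :=
  letI := Classical.decPred (· ∈ Set.range i)
  (Equiv.sumCongr (Equiv.ofInjective i hi) (Equiv.refl _)).trans (Equiv.sumCompl (· ∈ Set.range i))

@[simp] theorem splitEq_inl {ι E : Type} (i : ι → E) (hi : Function.Injective i) (k : ι) :
    splitEq i hi (.inl k) = i k := by
  simp [splitEq]

@[simp] theorem splitEq_inr {ι E : Type} (i : ι → E) (hi : Function.Injective i)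
    (e : {e // e ∉ Set.range i}) :
    splitEq i hi (.inr e) = e := by
  simp [splitEq]

noncomputable def splitU {U : Type} (u0 : U) :
    Unit ⊕ {u // u ∉ Set.range (fun _ : Unit => u0)} ≃ U :=
  splitEq (fun _ : Unit => u0) (fun _ _ _ => rfl)

@[simp] theorem splitU_inl {U : Type} (u0 : U) (k : Unit) :
    splitU u0 (.inl k) = u0 := splitEq_inl (fun _ : Unit => u0) _ k

@[simp] theorem splitU_inr {U : Type} (u0 : U) (e : {u // u ∉ Set.range (fun _ : Unit => u0)}) :
    splitU u0 (.inr e) = e := splitEq_inr (fun _ : Unit => u0) _ e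

theorem star_dvd' {E U K : Type} [Field K] [Fintype K] [DecidableEq E] [Fintype E] [DecidableEq U]
    [Fintype U] (B : Matrix E U K) (u0 : U) (i : Fin 3 → E) (hi : Function.Injective i)
    (h1 : ∀ k, B (i k) u0 * B (i k) u0 = 1) (h0 : ∀ e, e ∉ Set.range i → B e u0 = 0) :
    (Fintype.card K : ℤ) ^ 2 ∣ cnt (fun x => (bmat B x).det = 0) := by
  classical
  rw [← cnt_bmat_reindex (splitEq i hi) (splitU u0)]
  apply star_dvd
  · intro e; simpa using h0 _ e.2
  · intro k; simpa [sE] using h1 k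

def hmat {E U R : Type} (B : Matrix E U R) (a : E ⊕ U → R) : Matrix (Unit ⊕ E) U R :=
  of (Sum.elim (fun _ u => a (.inr u)) (fun e u => B e u))

theorem hmat_det {E U R : Type} [CommRing R] [DecidableEq E] [Fintype E] [DecidableEq U]
    [Fintype U] (B : Matrix E U R) (a : E ⊕ U → R) (ha : ∀ e, a (.inl e) = 0) (x : E → R)
    (t : Unit → R) :
    (bmat (hmat B a) (Sum.elim t x)).det = (bmat B x).det * t () + bform (bmat B x) a a := by
  rw [← bord_det, ← det_submatrix_equiv_self (Equiv.sumAssoc Unit E U)]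
  congr 1
  ext1 i j
  rcases i with (i | i) | i <;> rcases j with (j | j) | j <;>
    simp [bord, bmat, hmat, diagonal_apply, ha]

theorem hmat_count {E U K : Type} [Field K] [Fintype K] [DecidableEq E] [Fintype E] [DecidableEq U]
    [Fintype U] (B : Matrix E U K) (a : E ⊕ U → K) (ha : ∀ e, a (.inl e) = 0) :
    cnt (fun x => (bmat (hmat B a) x).det = 0) = (Fintype.card K : ℤ) *
      cnt (fun x => (bmat B x).det = 0 ∧ bform (bmat B x) a a = 0)
      + (Fintype.card K : ℤ) ^ Fintype.card E - cnt (fun x => (bmat B x).det = 0) := by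
  classical
  rw [← cnt_equiv (Equiv.sumArrowEquivProdArrow Unit E K).symm, cnt_prod]
  have : ∀ x : E → K, cnt (fun t : Unit → K => (bmat (hmat B a) ((Equiv.sumArrowEquivProdArrow Unit E K).symm (t, x))).det = 0)
     = (Fintype.card K : ℤ) * (if ((bmat B x).det = 0 ∧ bform (bmat B x) a a = 0) then 1 else 0)
      + 1 - (if (bmat B x).det = 0 then 1 else 0) := by
    intro x
    rw [← cnt_equiv (Equiv.funUnique Unit K).symm, cnt_congr (Q := fun t : K => (bmat B x).det * t + bform (bmat B x) a a = 0), cnt_lin]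
    · by_cases h1 : (bmat B x).det = 0 <;> by_cases h2 : bform (bmat B x) a a = 0 <;> simp [h1, h2]
    · intro t
      have := hmat_det B a ha x (fun _ => t)
      rw [← this]
      rfl
  simp only [this, Finset.sum_sub_distrib, Finset.sum_add_distrib, ← Finset.mul_sum]
  have hc : ∀ P : (E → K) → Prop, cnt P = ∑ x, if P x then 1 else 0 := by
    intro P; unfold cnt; exact Finset.sum_congr rfl fun x _ => by congr
  rw [hc, hc]
  simp only [Finset.sum_const, Finset.card_univ, Fintype.card_fun, nsmul_eq_mul, mul_one]
  push_cast
  congr!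

theorem vanish {E U K : Type} [Field K] [Fintype K] [DecidableEq E] [Fintype E] [DecidableEq U]
    [Fintype U] (p : ℕ) (hp : (p : ℤ) ∣ Fintype.card K)
    (B : Matrix E U K) (a : E ⊕ U → K) (ha : ∀ e, a (.inl e) = 0)
    (hE : 2 ≤ Fintype.card E)
    (h1 : (Fintype.card K : ℤ) ^ 2 ∣ cnt (fun x => (bmat (hmat B a) x).det = 0))
    (h2 : (p : ℤ) * (Fintype.card K : ℤ) ∣ cnt (fun x => (bmat B x).det = 0)) :
    (p : ℤ) ∣ cnt (fun x => (bmat B x).det = 0 ∧ bform (bmat B x) a a = 0) := by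
  have h := hmat_count B a ha
  have hq : (Fintype.card K : ℤ) ≠ 0 := by exact_mod_cast Fintype.card_ne_zero
  have hpq : (p : ℤ) * (Fintype.card K : ℤ) ∣ (Fintype.card K : ℤ) ^ 2 := by
    rw [sq]; exact mul_dvd_mul_right hp _
  have : (p : ℤ) * (Fintype.card K : ℤ) ∣ cnt (fun x => (bmat B x).det = 0 ∧ bform (bmat B x) a a = 0) * (Fintype.card K : ℤ) := by
    have e : cnt (fun x => (bmat B x).det = 0 ∧ bform (bmat B x) a a = 0) * (Fintype.card K : ℤ)
      = cnt (fun x => (bmat (hmat B a) x).det = 0) - (Fintype.card K : ℤ) ^ Fintype.card E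
        + cnt (fun x => (bmat B x).det = 0) := by rw [h]; ring
    rw [e]
    exact dvd_add (dvd_sub (hpq.trans h1) (hpq.trans (pow_dvd_pow _ hE))) h2
  exact (mul_dvd_mul_iff_right hq).mp this

theorem vanish1 {E U K : Type} [Field K] [Fintype K] [DecidableEq E] [Fintype E] [DecidableEq U]
    [Fintype U] (p : ℕ) (hp : (p : ℤ) ∣ Fintype.card K)
    (B : Matrix E U K) (a : E ⊕ U → K) (ha : ∀ e, a (.inl e) = 0)
    (hE : 2 ≤ Fintype.card E)
    (u0 : U) (i : Fin 3 → E) (hi : Function.Injective i)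
    (h1 : ∀ k, B (i k) u0 * B (i k) u0 = 1) (h0 : ∀ e, e ∉ Set.range i → B e u0 = 0)
    (hau : a (.inr u0) = 0) :
    (p : ℤ) ∣ cnt (fun x => (bmat B x).det = 0 ∧ bform (bmat B x) a a = 0) := by
  apply vanish p hp B a ha hE
  · apply star_dvd' _ u0 (fun k => .inr (i k)) (fun x y h => hi (Sum.inr_injective h))
    · intro k; exact h1 k
    · rintro (e | e) he
      · simpa [hmat] using hau
      · apply h0 e
        rintro ⟨k, rfl⟩
        exact he ⟨k, rfl⟩
  · refine dvd_trans ?_ (star_dvd' B u0 i hi h1 h0)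
    rw [sq]; exact mul_dvd_mul_right hp _

def e32 (E : Type) : Fin 3 ⊕ E ≃ Unit ⊕ (Fin 2 ⊕ E) where
  toFun := Sum.elim (Fin.cases (.inl ()) (fun j => .inr (.inl j))) (fun e => .inr (.inr e))
  invFun := Sum.elim (fun _ => .inl 0) (Sum.elim (fun j => .inl j.succ) .inr)
  left_inv := by
    rintro (i | e)
    · fin_cases i <;> rfl
    · rfl
  right_inv := by rintro (i | i | e) <;> rfl

theorem two_val {E U K : Type} [Field K] [Fintype K] [DecidableEq E] [Fintype E] [DecidableEq U]
    [Fintype U] (p : ℕ) [CharP K p] (hp : (p : ℤ) ∣ Fintype.card K)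
    (B : Matrix (Fin 2 ⊕ E) (Unit ⊕ U) K)
    (hU : 0 < Fintype.card U) (hE : Fintype.card U ≤ Fintype.card E)
    (h1 : ∀ k, B (.inl k) (.inl ()) * B (.inl k) (.inl ()) = 1)
    (h0 : ∀ e, B (.inr e) (.inl ()) = 0) :
    (p : ℤ) * (Fintype.card K : ℤ) ∣ cnt (fun x => (bmat B x).det = 0) := by
  classical
  let a : (Fin 2 ⊕ E) ⊕ (Unit ⊕ U) → K := Sum.elim (fun _ => 0) (Sum.elim (fun _ => 1) (fun _ => 0))
  let B3 : Matrix (Fin 3 ⊕ E) (Unit ⊕ U) K := (hmat B a).submatrix (e32 E) (Equiv.refl _)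
  have hB3 : ∀ e, B3 (.inr e) (.inl ()) = 0 := fun e => h0 e
  have hε : ∀ i, sE B3 i * sE B3 i = 1 := by
    intro i
    refine Fin.cases ?_ (fun j => ?_) i
    · simp [sE, B3, e32, hmat, a]
    · simpa [sE, B3, e32, hmat] using h1 j
  have key : ∀ x : E → K, ∃ c : K, ∀ β : Fin 2 → K,
      (bmat B (Sum.elim β x)).det = -((bmat (sB B3) x).det * (β 0 + β 1) + c) := by
    intro x
    obtain ⟨f, k1, k2⟩ := star_main (bmat (sB B3) x) (bmat_symm _ _) (sW B3) (sE B3) hε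
    refine ⟨bform (bmat (sB B3) x) (sw B3 1) (sw B3 1) + bform (bmat (sB B3) x) (sw B3 2) (sw B3 2)
      - 2 * bform (bmat (sB B3) x) (sw B3 1) (sw B3 2), fun β => ?_⟩
    have e1 : ∀ t : K, (bmat B (Sum.elim β x)).det * t + bform (bmat B (Sum.elim β x)) a a
        = (starM (bmat (sB B3) x) (sW B3) (sE B3) ![t, β 0, β 1]).det := by
      intro t
      rw [← hmat_det B a (fun _ => rfl) (Sum.elim β x) (fun _ => t), ← bmat_starM B3 hB3,
        ← bmat_reindex (e32 E) (Equiv.refl _)]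
      congr 2
      ext i
      rcases i with i | i
      · fin_cases i <;> rfl
      · rfl
    have t1 := e1 1
    have t0 := e1 0
    rw [k1] at t1 t0
    simp only [Matrix.cons_val_zero, Matrix.cons_val_one, Matrix.cons_val] at t1 t0
    unfold sw
    linear_combination t1 - t0
  choose c hc using key
  have hcnt : ∀ x : E → K, ∃ z : ℤ, cnt (fun β : Fin 2 → K => (bmat B (Sum.elim β x)).det = 0)
      = (Fintype.card K : ℤ) * (1 - if (bmat (sB B3) x).det = 0 then 1 else 0) + (Fintype.card K : ℤ) ^ 2 * z := by
    intro x
    by_cases h : (bmat (sB B3) x).det = 0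
    · by_cases hz : c x = 0
      · refine ⟨1, ?_⟩
        rw [cnt_true]
        · simp [h]
        · intro β; rw [hc, h, hz]; simp
      · refine ⟨0, ?_⟩
        rw [cnt_false]
        · simp [h]
        · intro β; rw [hc, h]; simpa using hz
    · refine ⟨0, ?_⟩
      rw [← cnt_equiv (finTwoArrowEquiv K).symm, cnt_prod]
      have : ∀ b : K, cnt (fun a : K => (bmat B (Sum.elim ((finTwoArrowEquiv K).symm (a, b)) x)).det = 0) = 1 := by
        intro b
        rw [← cnt_lin' (bmat (sB B3) x).det ((bmat (sB B3) x).det * b + c x) h]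
        apply cnt_congr
        intro a
        rw [hc, neg_eq_zero]
        simp [finTwoArrowEquiv]
        ring_nf
      simp only [this]
      simp [h]
  choose z hz using hcnt
  have hp0 := cw_bmat p (sB B3) hU hE
  rw [← cnt_equiv (Equiv.sumArrowEquivProdArrow (Fin 2) E K).symm, cnt_prod]
  have : ∀ x : E → K, cnt (fun t : Fin 2 → K => (bmat B ((Equiv.sumArrowEquivProdArrow (Fin 2) E K).symm (t, x))).det = 0)
     = cnt (fun β : Fin 2 → K => (bmat B (Sum.elim β x)).det = 0) := fun x => rfl
  simp only [this, hz]
  rw [Finset.sum_add_distrib, ← Finset.mul_sum, ← Finset.mul_sum, Finset.sum_sub_distrib]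
  have hcc : cnt (fun x => (bmat (sB B3) x).det = 0) = ∑ x, if (bmat (sB B3) x).det = 0 then 1 else 0 := by
    unfold cnt; exact Finset.sum_congr rfl fun x _ => by congr
  rw [← hcc]
  refine dvd_add ?_ ?_
  · rw [mul_comm (p : ℤ)]
    refine mul_dvd_mul_left _ (dvd_sub ?_ hp0)
    simp
    exact dvd_pow hp (by omega)
  · rw [sq, mul_assoc]
    rw [mul_comm (p : ℤ)]
    exact mul_dvd_mul_left _ (hp.mul_right _)

theorem vanish2 {E U K : Type} [Field K] [Fintype K] [DecidableEq E] [Fintype E] [DecidableEq U]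
    [Fintype U] (p : ℕ) [CharP K p] (hp : (p : ℤ) ∣ Fintype.card K)
    (B : Matrix E U K) (a : E ⊕ U → K) (ha : ∀ e, a (.inl e) = 0)
    (hU : 2 ≤ Fintype.card U) (hE : Fintype.card U + 1 ≤ Fintype.card E)
    (u0 : U) (i : Fin 2 → E) (hi : Function.Injective i)
    (h1 : ∀ k, B (i k) u0 * B (i k) u0 = 1) (h0 : ∀ e, e ∉ Set.range i → B e u0 = 0)
    (hau : a (.inr u0) * a (.inr u0) = 1) :
    (p : ℤ) ∣ cnt (fun x => (bmat B x).det = 0 ∧ bform (bmat B x) a a = 0) := by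
  classical
  apply vanish p hp B a ha (by omega)
  · apply star_dvd' _ u0 (Fin.cases (.inl ()) (fun k => .inr (i k)))
    · intro x y
      refine Fin.cases ?_ (fun x => ?_) x <;> refine Fin.cases ?_ (fun y => ?_) y
      · simp
      · simp
      · simp
      · intro h
        simp only [Fin.cases_succ, Sum.inr.injEq] at h
        rw [hi h]
    · intro k
      refine Fin.cases ?_ (fun k => ?_) k
      · simpa [hmat] using hau
      · simpa [hmat] using h1 k
    · rintro (e | e) he
      · exact absurd ⟨0, rfl⟩ he
      · apply h0 e
        rintro ⟨k, rfl⟩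
        exact he ⟨k.succ, rfl⟩
  · rw [← cnt_bmat_reindex (splitEq i hi) (splitU u0)]
    have c1 := Fintype.card_congr (splitEq i hi)
    have c2 := Fintype.card_congr (splitU u0)
    rw [Fintype.card_sum, Fintype.card_fin] at c1
    rw [Fintype.card_sum, Fintype.card_unit] at c2
    apply two_val p hp
    · omega
    · omega
    · intro k; simpa using h1 k
    · intro e; simpa using h0 _ e.2
end vanpart

section toppart

noncomputable def cm (σ : Type) [Fintype σ] (k : ℕ) : σ →₀ ℕ := Finsupp.equivFunOnFinite.symm (fun _ => k)

@[simp] theorem cm_apply (σ : Type) [Fintype σ] (k : ℕ) (i : σ) : cm σ k i = k := rfl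

theorem eq_cm {σ R : Type} [Fintype σ] [CommRing R] (P : MvPolynomial σ R) (k : ℕ)
    (h : P.totalDegree ≤ Fintype.card σ * k) (d : σ →₀ ℕ) (hd : d ∈ P.support) (hk : ∀ i, k ≤ d i) :
    d = cm σ k := by
  have h1 := (le_totalDegree hd).trans h
  rw [Finsupp.sum_fintype _ _ (fun _ => rfl)] at h1
  have h2 : ∑ i : σ, k = ∑ i, d i := by
    apply le_antisymm (Finset.sum_le_sum fun i _ => hk i)
    simpa using h1
  have h3 := (Finset.sum_eq_sum_iff_of_le (fun i _ => hk i)).mp h2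
  ext i
  exact (h3 i (Finset.mem_univ i)).symm

theorem sum_top {σ K k : Type} [Fintype σ] [DecidableEq σ] [CommRing k] [Field K] [Fintype K] [Algebra k K]
    (P : MvPolynomial σ k) (h : P.totalDegree ≤ Fintype.card σ * (Fintype.card K - 1)) :
    ∑ x : σ → K, aeval x P = (-1) ^ Fintype.card σ * algebraMap k K (coeff (cm σ (Fintype.card K - 1)) P) := by
  classical
  simp only [aeval_def, eval₂_eq']
  rw [Finset.sum_comm]
  have h1 : ∀ d ∈ P.support, ∑ x : σ → K, algebraMap k K (coeff d P) * ∏ i, x i ^ d i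
      = if d = cm σ (Fintype.card K - 1) then
        (-1) ^ Fintype.card σ * algebraMap k K (coeff (cm σ (Fintype.card K - 1)) P) else 0 := by
    intro d hd
    rw [← Finset.mul_sum]
    have h2 : ∑ x : σ → K, ∏ i, x i ^ d i = ∏ i, ∑ t : K, t ^ d i := by
      rw [Finset.prod_univ_sum, Fintype.piFinset_univ]
    rw [h2]
    split_ifs with hc
    · subst hc
      have : ∀ i : σ, ∑ t : K, t ^ (cm σ (Fintype.card K - 1) i) = -1 := by
        intro i
        rw [cm_apply]
        have hlt : Fintype.card K - 1 ≠ 0 := by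
          have := Fintype.one_lt_card (α := K); omega
        have : ∀ t : K, t ^ (Fintype.card K - 1) = 1 - if t = 0 then 1 else 0 := by
          intro t
          by_cases ht : t = 0
          · simp [ht, hlt]
          · simp [ht, FiniteField.pow_card_sub_one_eq_one t ht]
        simp only [this, Finset.sum_sub_distrib]
        simp
      rw [Finset.prod_congr rfl (fun i _ => this i)]
      simp [mul_comm]
    · have : ∃ i, d i < Fintype.card K - 1 := by
        by_contra hcon
        push Not at hcon
        exact hc (eq_cm P _ h d hd hcon)
      obtain ⟨i, hi⟩ := this
      rw [Finset.prod_eq_zero (Finset.mem_univ i) (FiniteField.sum_pow_lt_card_sub_one K _ hi), mul_zero]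
  rw [Finset.sum_congr rfl h1, Finset.sum_ite_eq']
  split_ifs with h3
  · rfl
  · rw [notMem_support_iff.mp h3]; simp

theorem coeff_step {σ : Type} [Fintype σ] [DecidableEq σ] (p : ℕ) [Fact p.Prime] (F : MvPolynomial σ (ZMod p))
    (h : F.totalDegree ≤ Fintype.card σ) (s : ℕ) :
    coeff (cm σ (p ^ (s + 1) - 1)) (F ^ (p ^ (s + 1) - 1))
      = coeff (cm σ (p - 1)) (F ^ (p - 1)) * coeff (cm σ (p ^ s - 1)) (F ^ (p ^ s - 1)) := by
  have hp : 2 ≤ p := (Fact.out : p.Prime).two_le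
  have hps : 1 ≤ p ^ s := Nat.one_le_pow _ _ (by omega)
  have e : p ^ (s + 1) - 1 = (p - 1) + p * (p ^ s - 1) := by
    rw [Nat.mul_sub, pow_succ, mul_comm p]
    have : p ≤ p ^ s * p := Nat.le_mul_of_pos_left _ hps
    omega
  have hF : F ^ (p ^ (s + 1) - 1) = F ^ (p - 1) * expand p (F ^ (p ^ s - 1)) := by
    rw [expand_zmod, ← pow_mul, ← pow_add, e, mul_comm p]
  have hm : cm σ (p ^ (s + 1) - 1) = cm σ (p - 1) + p • cm σ (p ^ s - 1) := by
    ext i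
    simp [e]
  rw [hF, coeff_mul]
  rw [Finset.sum_eq_single (cm σ (p - 1), p • cm σ (p ^ s - 1))]
  · rw [coeff_expand_smul _ (by omega)]
  · rintro ⟨u, v⟩ huv hne
    rw [Finset.HasAntidiagonal.mem_antidiagonal] at huv
    by_contra hcon
    have hu : coeff u (F ^ (p - 1)) ≠ 0 := left_ne_zero_of_mul hcon
    have hv : coeff v (expand p (F ^ (p ^ s - 1))) ≠ 0 := right_ne_zero_of_mul hcon
    have hdv : ∀ i, p ∣ v i := by
      by_contra hc
      push Not at hc
      obtain ⟨i, hi⟩ := hc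
      exact hv (coeff_expand_of_not_dvd _ hi)
    have : u = cm σ (p - 1) := by
      apply eq_cm (F ^ (p - 1)) (p - 1)
      · refine (totalDegree_pow _ _).trans ?_
        rw [mul_comm]
        exact Nat.mul_le_mul_right _ h
      · exact mem_support_iff.mpr hu
      · intro i
        obtain ⟨w, hw⟩ := hdv i
        have h1 := DFunLike.congr_fun huv i
        simp only [Finsupp.add_apply, cm_apply, hw] at h1
        rw [e] at h1
        by_contra hlt
        push Not at hlt
        have h2 : (u i + p * w) % p = (p - 1 + p * (p ^ s - 1)) % p := by rw [h1]
        rw [Nat.add_mul_mod_self_left, Nat.add_mul_mod_self_left, Nat.mod_eq_of_lt (by omega), Nat.mod_eq_of_lt (by omega)] at h2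
        omega
    apply hne
    rw [this, hm] at huv
    have hv2 : v = p • cm σ (p ^ s - 1) := add_left_cancel huv
    rw [this, hv2]
  · intro h
    exfalso
    apply h
    rw [Finset.HasAntidiagonal.mem_antidiagonal, hm]

theorem coeff_pow {σ : Type} [Fintype σ] [DecidableEq σ] (p : ℕ) [Fact p.Prime] (F : MvPolynomial σ (ZMod p))
    (h : F.totalDegree ≤ Fintype.card σ) (s : ℕ) :
    coeff (cm σ (p ^ s - 1)) (F ^ (p ^ s - 1)) = (coeff (cm σ (p - 1)) (F ^ (p - 1))) ^ s := by
  induction s with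
  | zero =>
    have : cm σ 0 = 0 := by ext i; simp
    simp [this]
  | succ s ih => rw [coeff_step p F h, ih, pow_succ, mul_comm]

theorem top_count {σ K : Type} [Fintype σ] [DecidableEq σ] (p s : ℕ) [Fact p.Prime] [Field K] [Fintype K]
    [Algebra (ZMod p) K] (hs : 1 ≤ s) (hK : Fintype.card K = p ^ s) (hσ : 0 < Fintype.card σ)
    (F : MvPolynomial σ (ZMod p)) (h : F.totalDegree ≤ Fintype.card σ) :
    ((cnt (fun x : σ → K => aeval x F = 0) : ℤ) : ZMod p)
      = -((-1) ^ Fintype.card σ * (coeff (cm σ (p - 1)) (F ^ (p - 1))) ^ s) := by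
  classical
  apply (algebraMap (ZMod p) K).injective
  have hp : 2 ≤ p := (Fact.out : p.Prime).two_le
  have h1 := sum_top (K := K) (F ^ (p ^ s - 1)) (by
    refine (totalDegree_pow _ _).trans ?_
    rw [mul_comm, hK]
    exact Nat.mul_le_mul_right _ h)
  rw [hK, coeff_pow p F h] at h1
  rw [map_intCast, map_neg, map_mul]
  simp only [map_pow, map_neg, map_one] at h1 ⊢
  rw [← h1]
  unfold cnt
  push_cast
  rw [eq_neg_iff_add_eq_zero, ← Finset.sum_add_distrib]
  have hlt : p ^ s - 1 ≠ 0 := by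
    have : p ^ 1 ≤ p ^ s := Nat.pow_le_pow_right (by omega) hs
    rw [pow_one] at this
    omega
  have : ∀ x : σ → K, ((if aeval x F = 0 then (1 : K) else 0) + (aeval x F) ^ (p ^ s - 1)) = 1 := by
    intro x
    by_cases hx : aeval x F = 0
    · simp [hx, hlt]
    · simp only [hx, if_false, zero_add]
      rw [← hK]; exact FiniteField.pow_card_sub_one_eq_one _ hx
  rw [Finset.sum_congr rfl (fun x _ => by convert this x using 2)]
  have hc : (Fintype.card K : K) = 0 := FiniteField.cast_card_eq_zero K
  simp [hc]
  omega
end toppart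

section corepart
open Matrix

def VC {E U : Type} (B : Matrix (Fin 3 ⊕ E) (Unit ⊕ U) ℤ) : Prop :=
  ∃ u0 : U,
    (∃ i : Fin 3 → E, Function.Injective i ∧ (∀ k, sB B (i k) u0 * sB B (i k) u0 = 1) ∧
      (∀ e, e ∉ Set.range i → sB B e u0 = 0) ∧ ∀ j, j ≠ 0 → sw B j (.inr u0) = 0) ∨
    (∃ i : Fin 2 → E, Function.Injective i ∧ (∀ k, sB B (i k) u0 * sB B (i k) u0 = 1) ∧
      (∀ e, e ∉ Set.range i → sB B e u0 = 0) ∧ ∀ j, j ≠ 0 → sw B j (.inr u0) * sw B j (.inr u0) = 1)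

theorem sw_map {E U R S : Type} [CommRing R] [CommRing S] (φ : R →+* S)
    (B : Matrix (Fin 3 ⊕ E) (Unit ⊕ U) R) (j : Fin 3) : sw (B.map φ) j = φ ∘ sw B j := by
  ext i
  rcases i with i | i <;> simp [sw, sE, sW]

theorem sB_map {E U R S : Type} [CommRing R] [CommRing S] (φ : R →+* S)
    (B : Matrix (Fin 3 ⊕ E) (Unit ⊕ U) R) : sB (B.map φ) = (sB B).map φ := rfl

theorem sw_inl {E U R : Type} [CommRing R]
    (B : Matrix (Fin 3 ⊕ E) (Unit ⊕ U) R) (j : Fin 3) (e : E) : sw B j (.inl e) = 0 := by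
  simp [sw, sE, sW]

noncomputable def topc {E U : Type} [DecidableEq E] [Fintype E] [DecidableEq U] [Fintype U] (p : ℕ)
    (B : Matrix (Fin 3 ⊕ E) (Unit ⊕ U) ℤ) : ZMod p :=
  coeff (cm E (p - 1)) ((pf (sB (B.map (Int.castRingHom (ZMod p)))) *
    pg (sB (B.map (Int.castRingHom (ZMod p)))) (sw (B.map (Int.castRingHom (ZMod p))) 1)
      (sw (B.map (Int.castRingHom (ZMod p))) 2)) ^ (p - 1))

theorem core {E U K : Type} [DecidableEq E] [Fintype E] [DecidableEq U] [Fintype U]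
    (p s : ℕ) [Fact p.Prime] [Field K] [Fintype K]
    [Algebra (ZMod p) K] (hs : 1 ≤ s) (hK : Fintype.card K = p ^ s)
    (B : Matrix (Fin 3 ⊕ E) (Unit ⊕ U) ℤ)
    (hB : ∀ e, B (.inr e) (.inl ()) = 0) (hε : ∀ i, sE B i * sE B i = 1)
    (hU : 2 ≤ Fintype.card U) (hE : Fintype.card E + 1 = 2 * Fintype.card U) (hV : VC B) :
    ∃ c : ℤ, cnt (fun x => (bmat (B.map (Int.castRingHom K)) x).det = 0)
      = ((p : ℤ) ^ s) ^ 2 * c ∧ (c : ZMod p) = -(topc p B) ^ s := by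
  have hchar : CharP K p := charP_of_injective_algebraMap (algebraMap (ZMod p) K).injective p
  have hq : (Fintype.card K : ℤ) = (p : ℤ) ^ s := by rw [hK]; push_cast; rfl
  have hp : (p : ℤ) ∣ Fintype.card K := by rw [hq]; exact dvd_pow_self _ (by omega)
  have hεK : ∀ i, sE (B.map (Int.castRingHom K)) i * sE (B.map (Int.castRingHom K)) i = 1 := by
    intro i
    have := congrArg (Int.castRingHom K) (hε i)
    rw [map_mul, map_one] at this
    exact this
  have hBK : ∀ e, (B.map (Int.castRingHom K)) (.inr e) (.inl ()) = 0 := by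
    intro e
    rw [Matrix.map_apply, hB, map_zero]
  obtain ⟨Z', hZ⟩ := star_count (B.map (Int.castRingHom K)) hBK hεK
  have hie := star_ie (B.map (Int.castRingHom K)) hεK
  have hvan : ∀ j : Fin 3, j ≠ 0 → (p : ℤ) ∣ cnt (fun x : E → K =>
      (bmat (sB (B.map (Int.castRingHom K))) x).det = 0 ∧
      bform (bmat (sB (B.map (Int.castRingHom K))) x) (sw (B.map (Int.castRingHom K)) j)
        (sw (B.map (Int.castRingHom K)) j) = 0) := by
    intro j hj
    have cast1 : ∀ a : ℤ, a * a = 1 → (Int.castRingHom K a) * (Int.castRingHom K a) = 1 := by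
      intro a ha; rw [← map_mul, ha, map_one]
    rcases hV with ⟨u0, ⟨i, h1, h2, h3, h4⟩ | ⟨i, h1, h2, h3, h4⟩⟩
    · apply vanish1 p hp _ _ (sw_inl _ j) (by omega) u0 i h1
      · intro k; exact cast1 _ (h2 k)
      · intro e he; rw [sB_map, Matrix.map_apply, h3 e he, map_zero]
      · rw [sw_map, Function.comp_apply, h4 j hj, map_zero]
    · apply vanish2 p hp _ _ (sw_inl _ j) (by omega) (by omega) u0 i h1
      · intro k; exact cast1 _ (h2 k)
      · intro e he; rw [sB_map, Matrix.map_apply, h3 e he, map_zero]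
      · rw [sw_map, Function.comp_apply]; exact cast1 _ (h4 j hj)
  set Z3 := cnt (fun x : E → K => (bmat (sB (B.map (Int.castRingHom K))) x).det = 0 ∧
    bform (bmat (sB (B.map (Int.castRingHom K))) x) (sw (B.map (Int.castRingHom K)) 1)
        (sw (B.map (Int.castRingHom K)) 1) = 0 ∧
    bform (bmat (sB (B.map (Int.castRingHom K))) x) (sw (B.map (Int.castRingHom K)) 2)
        (sw (B.map (Int.castRingHom K)) 2) = 0) with hZ3
  set Bp := B.map (Int.castRingHom (ZMod p)) with hBp
  have hmap : Bp.map (algebraMap (ZMod p) K) = B.map (Int.castRingHom K) := by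
    ext i j; simp [hBp]
  have hf : ∀ x : E → K, aeval x (pf (sB Bp)) = (bmat (sB (B.map (Int.castRingHom K))) x).det := by
    intro x; rw [pf_aeval, ← sB_map, hmap]
  have hg : ∀ x : E → K, aeval x (pg (sB Bp) (sw Bp 1) (sw Bp 2)) =
      bform (bmat (sB (B.map (Int.castRingHom K))) x) (sw (B.map (Int.castRingHom K)) 1)
        (sw (B.map (Int.castRingHom K)) 2) := by
    intro x; rw [pg_aeval, ← sB_map, ← sw_map, ← sw_map, hmap]
  have df := pf_deg (sB Bp) (by omega)
  have dg := pg_deg (sB Bp) (sw Bp 1) (sw Bp 2) (sw_inl _ _) (sw_inl _ _) (by omega)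
  have cwf : ∀ P : MvPolynomial E (ZMod p), P.totalDegree < Fintype.card E →
      (p : ℤ) ∣ cnt (fun x : E → K => aeval x P = 0) := by
    intro P hP
    have := cw (K := K) p (map (algebraMap (ZMod p) K) P) (lt_of_le_of_lt (Finset.sup_mono (support_map_subset _ _)) hP)
    rw [cnt_congr] at this
    · exact this
    · intro x; rw [eval_map, aeval_def]
  have cf := cwf _ (lt_of_le_of_lt df (by omega))
  have cg := cwf _ (lt_of_le_of_lt dg (by omega))
  have hprod := top_count (K := K) p s hs hK (by omega) (pf (sB Bp) * pg (sB Bp) (sw Bp 1) (sw Bp 2))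
    ((totalDegree_mul _ _).trans (by omega))
  have hodd : (-1 : ZMod p) ^ Fintype.card E = -1 := by
    apply Odd.neg_one_pow
    exact ⟨Fintype.card U - 1, by omega⟩
  rw [hodd, cnt_congr (Q := fun x : E → K => aeval x (pf (sB Bp)) = 0 ∨ aeval x (pg (sB Bp) (sw Bp 1) (sw Bp 2)) = 0),
    cnt_or] at hprod
  swap
  · intro x; rw [map_mul, mul_eq_zero]
  simp only [hf, hg] at hprod cf cg
  refine ⟨(Fintype.card K : ℤ) ^ Fintype.card E - Z3 + (Fintype.card K : ℤ) * Z', ?_, ?_⟩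
  · rw [hZ, ← hq]; ring
  · have z : ∀ a : ℤ, (p : ℤ) ∣ a → (a : ZMod p) = 0 := fun a ha => (ZMod.intCast_zmod_eq_zero_iff_dvd a p).mpr ha
    have v1 := z _ (hvan 1 (by decide))
    have v2 := z _ (hvan 2 (by decide))
    have e0 := congrArg (fun a : ℤ => (a : ZMod p)) hie
    have q0 := z _ hp
    have qE := z _ (dvd_pow hp (show Fintype.card E ≠ 0 by omega))
    have c1 := z _ cf
    have c2 := z _ cg
    unfold topc
    push_cast at e0 hprod q0 qE ⊢
    rw [v1, v2] at e0
    rw [c1, c2] at hprod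
    push_cast at q0
    rw [qE, q0]
    linear_combination -hprod - e0
end corepart

section treepart
open Matrix

def rowE {E U R : Type} [CommRing R] [DecidableEq E] (B : Matrix E U R) (e : E) (w : R × R) : E ⊕ U → R :=
  Sum.elim (Pi.single e w.1) (fun u => w.2 * B e u)

def matE {E U R : Type} [CommRing R] [DecidableEq E] (B : Matrix E U R) (C : Matrix U E R)
    (v : E → R × R) : Matrix (E ⊕ U) (E ⊕ U) R :=
  of (Sum.elim (fun e => rowE B e (v e)) (fun u => Sum.elim (C u) 0))

theorem matE_update {E U R : Type} [CommRing R] [DecidableEq E] [DecidableEq U] (B : Matrix E U R) (C : Matrix U E R)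
    (v : E → R × R) (e : E) (w : R × R) :
    matE B C (Function.update v e w) = (matE B C v).updateRow (.inl e) (rowE B e w) := by
  ext i j
  rcases i with i | i
  · by_cases h : i = e
    · subst h; simp [matE]
    · rw [updateRow_ne (by simpa using h)]; simp [matE, h]
  · rw [updateRow_ne (by simp)]; simp [matE]

def detE {E U R : Type} [CommRing R] [Fintype E] [Fintype U] [DecidableEq E] [DecidableEq U] (B : Matrix E U R) (C : Matrix U E R) :
    MultilinearMap R (fun _ : E => R × R) R :=
  MultilinearMap.mk' (fun v => (matE B C v).det)
    (by
      intro v e a b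
      rw [matE_update, matE_update, matE_update, ← det_updateRow_add]
      congr 2
      ext i
      rcases i with i | i <;> simp [rowE, Pi.single_apply, add_mul, ite_add_ite]
      )
    (by
      intro v e a b
      rw [matE_update, matE_update, smul_eq_mul, ← det_updateRow_smul]
      congr 2
      ext i
      rcases i with i | i <;> simp [rowE, Pi.single_apply, mul_assoc])

theorem det_expand {E U R : Type} [CommRing R] [Fintype E] [Fintype U] [DecidableEq E] [DecidableEq U]
    (B : Matrix E U R) (C : Matrix U E R) (x : E → R) :
    (fromBlocks (diagonal x) B C 0).det
      = ∑ S : Finset E, (∏ e ∈ S, x e) * (matE B C (S.piecewise (fun _ => (1, 0)) (fun _ => (0, 1)))).det := by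
  have h := (detE B C).map_add_univ (fun e => x e • ((1 : R), (0 : R))) (fun e => ((0 : R), (1 : R)))
  have h1 : (detE B C) ((fun e => x e • ((1 : R), (0 : R))) + (fun e => ((0 : R), (1 : R))))
     = (fromBlocks (diagonal x) B C 0).det := by
    show (matE B C _).det = _
    congr 1
    ext i j
    rcases i with i | i <;> rcases j with j | j <;> simp [matE, rowE, Pi.single_apply, diagonal_apply, eq_comm]
  rw [← h1, h]
  refine Finset.sum_congr rfl fun S _ => ?_
  have := (detE B C).map_piecewise_smul x (S.piecewise (fun _ => ((1 : R), (0 : R))) (fun _ => (0, 1))) S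
  have e1 : S.piecewise (fun i => x i • (S.piecewise (fun _ => ((1 : R), (0 : R))) (fun _ => (0, 1)) : E → R × R) i)
      (S.piecewise (fun _ => ((1 : R), (0 : R))) (fun _ => (0, 1)))
      = S.piecewise (fun i => x i • ((1 : R), (0 : R))) (fun _ => (0, 1)) := by
    ext i <;> by_cases hi : i ∈ S <;> simp [hi]
  rw [e1] at this
  rw [this]
  rfl

theorem matE_map {E U R R' : Type} [CommRing R] [CommRing R'] [Fintype E] [Fintype U] [DecidableEq E] [DecidableEq U]
    (φ : R →+* R') (B : Matrix E U R) (C : Matrix U E R) (S : Finset E) :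
    (matE (B.map φ) (C.map φ) (S.piecewise (fun _ => (1, 0)) (fun _ => (0, 1)))).det =
      φ (matE B C (S.piecewise (fun _ => (1, 0)) (fun _ => (0, 1)))).det := by
  rw [RingHom.map_det]
  congr 1
  ext i j
  rcases i with i | i <;> rcases j with j | j <;> simp [matE, rowE, Pi.single_apply]
  · by_cases h : i ∈ S <;> by_cases h2 : j = i <;> simp [h, h2]
  · by_cases h : i ∈ S <;> simp [h]

/-- inner determinant for S, with a right-inverse path matrix -/
theorem detS_tree {E U : Type} [Fintype E] [Fintype U] [DecidableEq E] [DecidableEq U]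
    (B : Matrix E U ℤ) (S : Finset E) (P : Matrix U E ℤ) (hP : ∀ u, ∀ e ∈ S, P u e = 0)
    (hPB : P * B = 1) (hc : (Sᶜ).card = Fintype.card U) :
    (matE B (-Bᵀ) (S.piecewise (fun _ => (1, 0)) (fun _ => (0, 1)))).det = 1 := by
  classical
  let BT : Matrix E U ℤ := of fun e u => if e ∈ S then 0 else B e u
  let BS : Matrix E U ℤ := of fun e u => if e ∈ S then B e u else 0
  let DS : Matrix E E ℤ := diagonal fun e => if e ∈ S then 1 else 0
  have h0 : matE B (-Bᵀ) (S.piecewise (fun _ => ((1 : ℤ), (0 : ℤ))) (fun _ => (0, 1))) = fromBlocks DS BT (-Bᵀ) 0 := by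
    ext i j
    rcases i with i | i <;> rcases j with j | j <;> simp [matE, rowE, Pi.single_apply, DS, BT, diagonal_apply]
    · by_cases h : i ∈ S <;> by_cases h2 : j = i <;> simp [h, h2]
      exact fun h3 => h2 h3.symm
    · by_cases h : i ∈ S <;> simp [h]
  have h1 : fromBlocks 1 0 BSᵀ 1 * fromBlocks DS BT (-Bᵀ) 0 = fromBlocks DS BT (-BTᵀ) 0 := by
    rw [fromBlocks_multiply]
    congr 1
    · simp
    · simp
    · ext u e
      simp only [DS, Matrix.add_apply, mul_diagonal, Matrix.one_mul, Matrix.neg_apply, transpose_apply, BS, BT, of_apply]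
      split_ifs <;> simp
    · ext u u'
      simp only [Matrix.mul_zero, add_zero, Matrix.mul_apply, BS, BT, transpose_apply, of_apply, Matrix.zero_apply]
      exact Finset.sum_eq_zero fun e _ => by split_ifs <;> simp
  have hPBT : P * BT = 1 := by
    rw [← hPB]
    ext u u'
    simp only [Matrix.mul_apply, BT, of_apply]
    refine Finset.sum_congr rfl fun e _ => ?_
    by_cases he : e ∈ S
    · simp [he, hP u e he]
    · simp [he]
  have hBP : BT * P = 1 - DS := by
    let B' : Matrix {e // e ∉ S} U ℤ := of fun e u => B e u
    let P' : Matrix U {e // e ∉ S} ℤ := of fun u e => P u e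
    have k1 : P' * B' = 1 := by
      rw [← hPB]
      ext u u'
      simp only [Matrix.mul_apply, B', P', of_apply]
      rw [← Finset.sum_subset (Finset.subset_univ (Sᶜ))]
      · rw [← Finset.sum_subtype (F := inferInstance) (s := Sᶜ) (p := fun e => e ∉ S) (f := fun e => P u e * B e u')]
        intro e; simp
      · intro e _ he
        rw [hP u e (by simpa using he), zero_mul]
    have k2 : B' * P' = 1 := by
      refine (Matrix.mul_eq_one_comm_of_card_eq _ _ _ ?_).mp k1
      rw [← hc, Fintype.card_subtype]
      congr 1; ext; simp
    ext e f
    by_cases he : e ∈ S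
    · simp [Matrix.mul_apply, BT, he, DS, Matrix.one_apply, diagonal_apply]
    · by_cases hf : f ∈ S
      · have : e ≠ f := fun h => he (h ▸ hf)
        simp [Matrix.mul_apply, hP _ f hf, DS, Matrix.one_apply, diagonal_apply, this]
      · have := congrFun (congrFun k2 ⟨e, he⟩) ⟨f, hf⟩
        simp only [Matrix.mul_apply, B', P', of_apply, Matrix.one_apply, Subtype.mk.injEq] at this
        simp [Matrix.mul_apply, BT, he, DS, Matrix.one_apply, diagonal_apply, this]
  have h2 : fromBlocks DS BT (-BTᵀ) 0 * fromBlocks 1 0 P 1 = fromBlocks 1 BT (-BTᵀ) 0 := by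
    rw [fromBlocks_multiply]
    congr 1
    · rw [hBP]; simp
    · simp
    · simp
    · simp
  have d1 := congrArg det h1
  have d2 := congrArg det h2
  rw [det_mul, det_fromBlocks_zero₁₂] at d1 d2
  rw [det_fromBlocks_one₁₁] at d2
  simp only [det_one, one_mul, mul_one, Matrix.neg_mul, sub_neg_eq_add, zero_add] at d1 d2
  rw [h0, d1, d2]
  have hunit : (BTᵀ * BT).det * (P * Pᵀ).det = 1 := by
    rw [← det_mul]
    have : BTᵀ * BT * (P * Pᵀ) = 1 := by
      calc BTᵀ * BT * (P * Pᵀ) = BTᵀ * (BT * P) * Pᵀ := by simp only [Matrix.mul_assoc]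
        _ = (P * BT)ᵀ - (BTᵀ * DS) * Pᵀ := by rw [hBP]; simp [Matrix.mul_sub, Matrix.sub_mul]
        _ = 1 := by
          have : BTᵀ * DS = 0 := by
            ext u e; simp only [DS, mul_diagonal, transpose_apply, BT, of_apply]; split_ifs <;> simp
          rw [this, hPBT]; simp
    rw [this, det_one]
  have hnn : 0 ≤ (BTᵀ * BT).det := by
    have := (posSemidef_conjTranspose_mul_self (BT.map (Int.castRingHom ℝ))).det_nonneg
    have e : (BT.map (Int.castRingHom ℝ))ᴴ * BT.map (Int.castRingHom ℝ) = (BTᵀ * BT).map (Int.castRingHom ℝ) := by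
      rw [Matrix.map_mul]; rfl
    rw [e, ← RingHom.mapMatrix_apply, ← RingHom.map_det] at this
    simpa using this
  rcases Int.isUnit_iff.mp (IsUnit.of_mul_eq_one _ hunit) with h | h
  · exact h
  · omega

theorem detS_ker {E U : Type} [Fintype E] [Fintype U] [DecidableEq E] [DecidableEq U]
    (B : Matrix E U ℤ) (S : Finset E) (z : U → ℤ) (hz : z ≠ 0) (h : ∀ e, e ∉ S → ∑ u, B e u * z u = 0) :
    (matE B (-Bᵀ) (S.piecewise (fun _ => (1, 0)) (fun _ => (0, 1)))).det = 0 := by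
  rw [← exists_mulVec_eq_zero_iff]
  refine ⟨Sum.elim 0 z, ?_, ?_⟩
  · intro h0
    apply hz
    ext u
    exact congrFun h0 (.inr u)
  · ext i
    rcases i with i | i
    · by_cases hi : i ∈ S
      · simp [matE, rowE, mulVec, dotProduct, hi]
      · simpa [matE, rowE, mulVec, dotProduct, hi] using h i hi
    · simp [matE, mulVec, dotProduct]

theorem detS_ker2 {E U : Type} [Fintype E] [Fintype U] [DecidableEq E] [DecidableEq U]
    (B : Matrix E U ℤ) (S : Finset E) (hc : Fintype.card U < (Sᶜ).card) :
    (matE B (-Bᵀ) (S.piecewise (fun _ => (1, 0)) (fun _ => (0, 1)))).det = 0 := by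
  classical
  let L : ({e // e ∈ Sᶜ} → ℤ) →ₗ[ℤ] (U → ℤ) := Matrix.mulVecLin (of fun u e => B e u)
  have hk : LinearMap.ker L ≠ ⊥ := by
    intro hk
    have := LinearMap.finrank_le_finrank_of_injective (LinearMap.ker_eq_bot.mp hk)
    simp only [Module.finrank_fintype_fun_eq_card, Fintype.card_coe] at this
    omega
  obtain ⟨y, hy, hy0⟩ := (Submodule.ne_bot_iff _).mp hk
  rw [LinearMap.mem_ker] at hy
  rw [← exists_mulVec_eq_zero_iff]
  let y' : E → ℤ := fun e => if h : e ∈ Sᶜ then y ⟨e, h⟩ else 0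
  refine ⟨Sum.elim y' 0, ?_, ?_⟩
  · intro h0
    apply hy0
    ext e
    have := congrFun h0 (.inl e)
    simp only [Sum.elim_inl, y', e.2, dif_pos] at this
    exact this
  · ext i
    rcases i with i | i
    · by_cases hi : i ∈ S
      · simp only [matE, rowE, mulVec, dotProduct, hi, of_apply, Sum.elim_inl, Finset.piecewise_eq_of_mem, Fintype.sum_sum_type, Sum.elim_inr, Pi.zero_apply, mul_zero, Finset.sum_const_zero, add_zero]
        refine Finset.sum_eq_zero fun a _ => ?_
        by_cases ha : a = i
        · subst ha; simp [y', hi]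
        · simp [Pi.single_apply, ha]
      · simp [matE, rowE, mulVec, dotProduct, hi]
    · have h1 := congrFun hy i
      simp only [L, mulVecLin_apply, mulVec, dotProduct, of_apply, Pi.zero_apply] at h1
      have h2 : ∑ e : E, B e i * y' e = 0 := by
        rw [← h1, ← Finset.sum_subset (Finset.subset_univ (Sᶜ))]
        · rw [← Finset.sum_coe_sort]
          refine Finset.sum_congr rfl fun e _ => ?_
          simp only [y', e.2, dif_pos]
        · intro e _ he
          simp only [y', he]; simp
      simp [matE, mulVec, dotProduct, h2]
end treepart

section graphpart
open Matrix

noncomputable def inc {V : Type} [DecidableEq V] (e : Sym2 V) (w : V) : ℤ :=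
  (if w = (Quot.out e).2 then 1 else 0) - (if w = (Quot.out e).1 then 1 else 0)

theorem out_mk {V : Type} (e : Sym2 V) : s((Quot.out e).1, (Quot.out e).2) = e := by
  have := Quot.out_eq e
  exact this

theorem inc_mk {V : Type} [DecidableEq V] (a b : V) :
    (∀ w, inc s(a, b) w = (if w = b then 1 else 0) - (if w = a then 1 else 0)) ∨
    (∀ w, inc s(a, b) w = -((if w = b then 1 else 0) - (if w = a then 1 else 0))) := by
  have h := out_mk s(a, b)
  rw [Sym2.eq_iff] at h
  rcases h with ⟨h1, h2⟩ | ⟨h1, h2⟩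
  · left; intro w; rw [inc, h1, h2]
  · right; intro w; rw [inc, h1, h2]; ring

theorem inc_not_mem {V : Type} [DecidableEq V] (e : Sym2 V) (w : V) (h : w ∉ e) : inc e w = 0 := by
  induction e using Sym2.ind with
  | _ a b =>
    rw [Sym2.mem_iff] at h
    push Not at h
    rcases inc_mk a b with h1 | h1 <;> rw [h1] <;> simp [h.1, h.2]

theorem inc_mem {V : Type} [DecidableEq V] (e : Sym2 V) (w : V) (h : w ∈ e) (hd : ¬ e.IsDiag) :
    inc e w * inc e w = 1 := by
  induction e using Sym2.ind with
  | _ a b =>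
    rw [Sym2.mem_iff] at h
    have hab : a ≠ b := by simpa using hd
    rcases h with rfl | rfl
    · rcases inc_mk w b with h1 | h1 <;> rw [h1] <;> simp [hab]
    · rcases inc_mk a w with h1 | h1 <;> rw [h1] <;> simp [hab.symm]

theorem inc_sum {V : Type} [DecidableEq V] [Fintype V] (a b : V) (f : V → ℤ) (h : f a = f b) :
    ∑ w, inc s(a, b) w * f w = 0 := by
  have k : ∑ w, ((if w = b then (1 : ℤ) else 0) - (if w = a then 1 else 0)) * f w = 0 := by
    simp [sub_mul, Finset.sum_sub_distrib, h]
  rcases inc_mk a b with h1 | h1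
  · simp_rw [h1]; exact k
  · simp_rw [h1, neg_mul, Finset.sum_neg_distrib, k, neg_zero]

theorem path_lem {V : Type} [DecidableEq V] {E : Type} [Fintype E] [DecidableEq E] (ι : E → Sym2 V)
    (T : Set E) (H : SimpleGraph V) (hH : ∀ a b, H.Adj a b → ∃ e ∈ T, ι e = s(a, b))
    (r v : V) (h : H.Reachable r v) :
    ∃ c : E → ℤ, (∀ e, e ∉ T → c e = 0) ∧
      ∀ w, ∑ e, c e * inc (ι e) w = (if w = v then 1 else 0) - (if w = r then 1 else 0) := by
  obtain ⟨p⟩ := h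
  induction p with
  | nil => exact ⟨0, by simp, by simp⟩
  | @cons u v w hadj p ih =>
    obtain ⟨c, hc, hs⟩ := ih
    obtain ⟨e, he, hee⟩ := hH _ _ hadj
    rcases inc_mk u v with h1 | h1
    · refine ⟨c + Pi.single e 1, fun f hf => ?_, fun x => ?_⟩
      · have : f ≠ e := fun h => hf (h ▸ he)
        simp [hc f hf, this]
      · simp only [Pi.add_apply, add_mul, Finset.sum_add_distrib, hs, Pi.single_apply, ite_mul, zero_mul,
          Finset.sum_ite_eq', Finset.mem_univ, if_true, hee, h1]
        ring
    · refine ⟨c + Pi.single e (-1), fun f hf => ?_, fun x => ?_⟩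
      · have : f ≠ e := fun h => hf (h ▸ he)
        simp [hc f hf, this]
      · simp only [Pi.add_apply, add_mul, Finset.sum_add_distrib, hs, Pi.single_apply, ite_mul, zero_mul,
          Finset.sum_ite_eq', Finset.mem_univ, if_true, hee, h1]
        ring

noncomputable def gB {V : Type} [Fintype V] [DecidableEq V] (G : SimpleGraph V) [DecidableRel G.Adj] (r : V) :
    Matrix ↥G.edgeFinset {u : V // u ≠ r} ℤ := of fun e u => inc (e : Sym2 V) (u : V)

open Classical in
theorem detS_graph {V : Type} [Fintype V] [DecidableEq V] (G : SimpleGraph V) [DecidableRel G.Adj] (r : V)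
    (S : Finset ↥G.edgeFinset) :
    (matE (gB G r) (-(gB G r)ᵀ) (S.piecewise (fun _ => (1, 0)) (fun _ => (0, 1)))).det =
      if (SimpleGraph.fromEdgeSet ((Sᶜ.map (Function.Embedding.subtype _) : Finset (Sym2 V)) : Set (Sym2 V))).IsTree
      then 1 else 0 := by
  set T : Finset (Sym2 V) := Sᶜ.map (Function.Embedding.subtype _) with hT
  set H := SimpleGraph.fromEdgeSet (T : Set (Sym2 V)) with hH
  have memT : ∀ e : ↥G.edgeFinset, (e : Sym2 V) ∈ T ↔ e ∉ S := by
    intro e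
    rw [hT, Finset.mem_map]
    constructor
    · rintro ⟨f, hf, hfe⟩
      have : f = e := Subtype.ext hfe
      subst this; simpa using hf
    · intro h; exact ⟨e, by simpa using h, rfl⟩
  have subT : ∀ e ∈ T, e ∈ G.edgeFinset := by
    intro e he
    rw [hT, Finset.mem_map] at he
    obtain ⟨f, hf, rfl⟩ := he
    exact f.2
  have hdiag : ∀ e ∈ T, ¬ e.IsDiag := fun e he =>
    G.not_isDiag_of_mem_edgeSet (SimpleGraph.mem_edgeFinset.mp (subT e he))
  have hedge : H.edgeSet = (T : Set (Sym2 V)) := by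
    rw [hH, SimpleGraph.edgeSet_fromEdgeSet]
    ext e
    constructor
    · exact fun h => h.1
    · exact fun h => ⟨h, hdiag e h⟩
  have hcardE : Nat.card H.edgeSet = (Sᶜ).card := by
    rw [hedge, Nat.card_eq_card_toFinset, Finset.toFinset_coe, hT, Finset.card_map]
  have hcardU : Fintype.card {u : V // u ≠ r} + 1 = Nat.card V := by
    rw [Fintype.card_subtype_compl, Fintype.card_subtype_eq, Nat.card_eq_fintype_card]
    have : 0 < Fintype.card V := Fintype.card_pos_iff.mpr ⟨r⟩
    omega
  have hadj : ∀ a b, H.Adj a b → ∃ e ∈ {e : ↥G.edgeFinset | e ∉ S}, (e : Sym2 V) = s(a, b) := by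
    intro a b hab
    have h1 : s(a, b) ∈ T := by
      have : s(a, b) ∈ H.edgeSet := hab
      rw [hedge] at this; exact this
    exact ⟨⟨_, subT _ h1⟩, (memT _).mp h1, rfl⟩
  by_cases hcon : H.Connected
  · by_cases hcd : (Sᶜ).card = Fintype.card {u : V // u ≠ r}
    · have ht : H.IsTree := by
        rw [SimpleGraph.isTree_iff_connected_and_card]
        exact ⟨hcon, by omega⟩
      rw [if_pos ht]
      choose P hP1 hP2 using fun u : {u : V // u ≠ r} =>
        path_lem (fun e : ↥G.edgeFinset => (e : Sym2 V)) {e | e ∉ S} H hadj r u (hcon.preconnected r u)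
      refine detS_tree _ S (of P) (fun u e he => hP1 u e (by simpa using he)) ?_ hcd
      ext u w
      simp only [Matrix.mul_apply, of_apply, gB]
      rw [hP2, if_neg w.2, Matrix.one_apply]
      simp [Subtype.ext_iff, eq_comm]
    · have ht : ¬ H.IsTree := by
        rw [SimpleGraph.isTree_iff_connected_and_card]
        rintro ⟨_, h⟩
        omega
      rw [if_neg ht]
      apply detS_ker2
      have := hcon.card_vert_le_card_edgeSet_add_one
      omega
  · rw [if_neg (fun h => hcon h.connected)]
    have : ∃ v, ¬ H.Reachable r v := by
      by_contra! hh
      apply hcon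
      haveI : Nonempty V := ⟨r⟩
      exact ⟨fun a b => (hh a).symm.trans (hh b)⟩
    obtain ⟨v, hv⟩ := this
    have hvr : v ≠ r := by rintro rfl; exact hv (SimpleGraph.Reachable.refl _)
    refine detS_ker _ S (fun u => if H.Reachable r u then 0 else 1) ?_ ?_
    · intro h0
      have := congrFun h0 ⟨v, hvr⟩
      simp [hv] at this
    · intro e he
      obtain ⟨e, hee⟩ := e
      induction e using Sym2.ind with
      | _ a b =>
        have hab : H.Adj a b := by
          have : s(a, b) ∈ H.edgeSet := by
            rw [hedge]; exact (memT ⟨_, hee⟩).mpr he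
          exact this
        have hre : H.Reachable r a ↔ H.Reachable r b :=
          ⟨fun h => h.trans hab.reachable, fun h => h.trans hab.symm.reachable⟩
        have := inc_sum a b (fun u => if H.Reachable r u then 0 else 1) (by simp [hre])
        refine Eq.trans ?_ this
        simp only [gB, of_apply]
        rw [← Finset.sum_subtype (F := inferInstance) (s := Finset.univ.filter (fun u => u ≠ r)) (p := fun u => u ≠ r)
          (f := fun u => inc s(a,b) u * if H.Reachable r u then 0 else 1) (by simp)]
        apply Finset.sum_subset (Finset.subset_univ _)
        intro x _ hx
        have : x = r := by simpa using hx
        subst this; simp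

open Classical in
theorem kirchhoff_det {V K : Type} [Fintype V] [DecidableEq V] (G : SimpleGraph V) [DecidableRel G.Adj] (r : V)
    [Field K] (x : ↥G.edgeFinset → K) :
    aeval x (kirchhoff G) = (fromBlocks (diagonal x) ((gB G r).map (Int.castRingHom K))
      ((-(gB G r)ᵀ).map (Int.castRingHom K)) 0).det := by
  have key : ∀ T : Finset (Sym2 V), T ⊆ G.edgeFinset →
      ((Finset.univ.filter (fun e : ↥G.edgeFinset => (e : Sym2 V) ∉ T))ᶜ).map (Function.Embedding.subtype _) = T := by
    intro T hT
    ext e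
    simp only [Finset.mem_map, Finset.mem_compl, Finset.mem_filter, Finset.mem_univ, true_and, not_not]
    constructor
    · rintro ⟨f, hf, rfl⟩; exact hf
    · intro h; exact ⟨⟨e, hT h⟩, h, rfl⟩
  have hmem : ∀ T : Set (Sym2 V), (T ∈ do
      let a ← G.edgeFinset.powerset
      pure (a : Set (Sym2 V))) ↔ ∃ T' : Finset (Sym2 V), T' ⊆ G.edgeFinset ∧ T = (T' : Set (Sym2 V)) := by
    intro T
    simp only [Finset.bind_def, Finset.mem_sup, Finset.pure_def, Finset.mem_singleton, Finset.mem_powerset]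
  rw [det_expand, kirchhoff, map_sum]
  simp_rw [matE_map, detS_graph]
  rw [← Finset.sum_filter_of_ne (p := fun S : Finset ↥G.edgeFinset => 
    (SimpleGraph.fromEdgeSet ((Sᶜ.map (Function.Embedding.subtype _) : Finset (Sym2 V)) : Set (Sym2 V))).IsTree)
    (by intro S _ h; by_contra h2; rw [if_neg h2] at h; simp at h)]
  refine Finset.sum_nbij' (fun T => Finset.univ.filter (fun e : ↥G.edgeFinset => (e : Sym2 V) ∉ T))
    (fun S => ((Sᶜ.map (Function.Embedding.subtype _) : Finset (Sym2 V)) : Set (Sym2 V))) ?_ ?_ ?_ ?_ ?_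
  · intro T hT
    rw [Finset.mem_filter, hmem] at hT
    obtain ⟨⟨T, hT1, rfl⟩, hT2⟩ := hT
    simp only [Finset.mem_coe]
    rw [Finset.mem_filter]
    refine ⟨Finset.mem_univ _, ?_⟩
    rw [key T hT1]; exact hT2
  · intro S hS
    rw [Finset.mem_filter] at hS
    rw [Finset.mem_filter, hmem]
    refine ⟨⟨_, ?_, rfl⟩, hS.2⟩
    intro e he
    rw [Finset.mem_map] at he
    obtain ⟨f, hf, rfl⟩ := he
    exact f.2
  · intro T hT
    rw [Finset.mem_filter, hmem] at hT
    obtain ⟨⟨T, hT1, rfl⟩, hT2⟩ := hT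
    simp only [Finset.mem_coe]
    rw [key T hT1]
  · intro S _
    ext e
    simp
  · intro T hT
    rw [Finset.mem_filter, hmem] at hT
    obtain ⟨⟨T, hT1, rfl⟩, hT2⟩ := hT
    simp only [Finset.mem_coe]
    rw [key T hT1, if_pos hT2]
    simp

end graphpart

section assembly
open Matrix

theorem kirchhoff_zero {V K : Type} [Fintype V] [DecidableEq V] (G : SimpleGraph V) [DecidableRel G.Adj] (r : V)
    [Field K] (x : ↥G.edgeFinset → K) :
    aeval x (kirchhoff G) = 0 ↔ (bmat ((gB G r).map (Int.castRingHom K)) x).det = 0 := by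
  rw [kirchhoff_det G r]
  have h : fromBlocks 1 0 0 (-1) * bmat ((gB G r).map (Int.castRingHom K)) x =
    fromBlocks (diagonal x) ((gB G r).map (Int.castRingHom K))
      ((-(gB G r)ᵀ).map (Int.castRingHom K)) 0 := by
    rw [bmat, fromBlocks_multiply]
    congr 1
    · simp
    · simp
    · ext i j; simp
    · simp
  rw [← h, det_mul, det_fromBlocks_zero₁₂, det_neg]
  simp

theorem gfacts {V : Type} [Fintype V] [DecidableEq V] (G : SimpleGraph V) [DecidableRel G.Adj]
    (K : SimpleGraph (Option V)) (h4 : ∀ w, (K.neighborSet w).ncard = 4)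
    (hKG : ∀ a b : V, K.Adj (some a) (some b) ↔ G.Adj a b) :
    ∃ N : Finset V, N.card = 4 ∧ ∀ v, G.degree v + (if v ∈ N then 1 else 0) = 4 := by
  classical
  refine ⟨Finset.univ.filter (fun v => K.Adj none (some v)), ?_, ?_⟩
  · rw [← h4 none, ← Set.ncard_coe_finset, ← Set.ncard_image_of_injective _ (Option.some_injective V)]
    congr 1
    ext w
    rcases w with _ | w <;> simp
  · intro v
    have h1 : (some '' (G.neighborSet v)).ncard = G.degree v := by
      rw [Set.ncard_image_of_injective _ (Option.some_injective V), Set.ncard_eq_toFinset_card']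
      rfl
    rw [← h4 (some v), ← h1]
    by_cases hv : K.Adj none (some v)
    · rw [if_pos (by simpa using hv), ← Set.ncard_insert_of_notMem (a := none) (by simp) (Set.toFinite _)]
      congr 1
      ext w
      rcases w with _ | w
      · simpa using hv.symm
      · simp [hKG]
    · rw [if_neg (by simpa using hv), add_zero]
      congr 1
      ext w
      rcases w with _ | w
      · simpa using fun h => hv (SimpleGraph.Adj.symm h)
      · simp [hKG]

theorem card_star {V : Type} [Fintype V] [DecidableEq V] (G : SimpleGraph V) [DecidableRel G.Adj] (v : V) :
    (Finset.univ.filter (fun e : ↥G.edgeFinset => v ∈ (e : Sym2 V))).card = G.degree v := by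
  rw [← SimpleGraph.card_incidenceFinset_eq_degree, SimpleGraph.incidenceFinset_eq_filter,
    ← Finset.card_map (Function.Embedding.subtype _)]
  congr 1
  ext e
  simp [and_comm]

theorem enum_fin {α : Type} (n : ℕ) (F : Finset α) (h : F.card = n) :
    ∃ i : Fin n → α, Function.Injective i ∧ ∀ e, e ∈ Set.range i ↔ e ∈ F := by
  let f := (F.equivFinOfCardEq h).symm
  refine ⟨fun k => f k, fun a b hab => f.injective (Subtype.ext hab), fun e => ⟨?_, ?_⟩⟩
  · rintro ⟨k, rfl⟩; exact (f k).2
  · intro he; exact ⟨f.symm ⟨e, he⟩, by simp⟩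

theorem star_enum {V : Type} [Fintype V] [DecidableEq V] (G : SimpleGraph V) [DecidableRel G.Adj] (v w : V)
    (hvw : v ≠ w) (hd : G.degree v = 3) :
    ∃ i : Fin 3 → ↥G.edgeFinset, Function.Injective i ∧ (∀ e, e ∈ Set.range i ↔ v ∈ (e : Sym2 V)) ∧
      ∀ j, j ≠ 0 → w ∉ (i j : Sym2 V) := by
  obtain ⟨i, hi, hr⟩ := enum_fin 3 _ ((card_star G v).trans hd)
  have hr' : ∀ e, e ∈ Set.range i ↔ v ∈ (e : Sym2 V) := by
    intro e; rw [hr]; simp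
  have huniq : ∀ j k, w ∈ (i j : Sym2 V) → w ∈ (i k : Sym2 V) → j = k := by
    intro j k hj hk
    apply hi
    apply Subtype.ext
    have h1 := (hr' (i j)).mp ⟨j, rfl⟩
    have h2 := (hr' (i k)).mp ⟨k, rfl⟩
    rw [(Sym2.mem_and_mem_iff hvw).mp ⟨h1, hj⟩, (Sym2.mem_and_mem_iff hvw).mp ⟨h2, hk⟩]
  by_cases hex : ∃ k, w ∈ (i k : Sym2 V)
  · obtain ⟨k, hk⟩ := hex
    refine ⟨i ∘ Equiv.swap 0 k, hi.comp (Equiv.injective _), fun e => ?_, fun j hj hw => ?_⟩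
    · rw [(Equiv.surjective _).range_comp]; exact hr' e
    · have := huniq _ _ hw hk
      apply hj
      apply (Equiv.swap 0 k).injective
      rw [this]; simp
  · exact ⟨i, hi, hr', fun j _ hw => hex ⟨j, hw⟩⟩

theorem main_a {V : Type} [Fintype V] [DecidableEq V] (G : SimpleGraph V) [DecidableRel G.Adj]
    (hG : IsPrimitiveDivergent G) (p : ℕ) [Fact p.Prime] :
    ∃ a : ZMod p, ∀ s, 1 ≤ s → ∃ c : ℤ, (pointCount p s (kirchhoff G) : ℤ) = ((p : ℤ) ^ s) ^ 2 * c ∧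
      (c : ZMod p) = - a ^ s := by
  classical
  obtain ⟨-, K, -, h4, -, hKG⟩ := hG
  obtain ⟨N, hN, hdeg⟩ := gfacts G K h4 hKG
  have hV4 : 4 ≤ Fintype.card V := by rw [← hN]; exact Finset.card_le_univ N
  have hE : G.edgeFinset.card + 2 = 2 * Fintype.card V := by
    have h1 := G.sum_degrees_eq_twice_card_edges
    have h2 : ∑ v, (G.degree v + (if v ∈ N then 1 else 0)) = Fintype.card V * 4 := by
      simp [hdeg]
    rw [Finset.sum_add_distrib, h1, Finset.sum_ite_mem, Finset.univ_inter] at h2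
    simp [hN] at h2
    omega
  obtain ⟨v, hvN, w, hwN, hvw⟩ := Finset.one_lt_card.mp (show 1 < N.card by omega)
  obtain ⟨r, hr⟩ : ∃ r, r ∉ ({v, w} : Finset V) := by
    by_contra! h
    have := Finset.card_le_card (fun x _ => h x : (Finset.univ : Finset V) ⊆ {v, w})
    have h2 := Finset.card_le_two (a := v) (b := w)
    rw [Finset.card_univ] at this
    omega
  simp only [Finset.mem_insert, Finset.mem_singleton, not_or] at hr
  have hdv : G.degree v = 3 := by have := hdeg v; simp [hvN] at this; omega
  have hdw : G.degree w = 3 := by have := hdeg w; simp [hwN] at this; omega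
  obtain ⟨i, hi, hir, hij⟩ := star_enum G v w hvw hdv
  have hdiag : ∀ e : ↥G.edgeFinset, ¬ (e : Sym2 V).IsDiag := fun e =>
    G.not_isDiag_of_mem_edgeSet (SimpleGraph.mem_edgeFinset.mp e.2)
  let v' : {u : V // u ≠ r} := ⟨v, fun h => hr.1 h.symm⟩
  let w' : {u : {u : V // u ≠ r} // u ∉ Set.range (fun _ : Unit => v')} :=
    ⟨⟨w, fun h => hr.2 h.symm⟩, by rintro ⟨_, h⟩; exact hvw (congrArg Subtype.val h)⟩
  let B : Matrix (Fin 3 ⊕ {e : ↥G.edgeFinset // e ∉ Set.range i})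
      (Unit ⊕ {u : {u : V // u ≠ r} // u ∉ Set.range (fun _ : Unit => v')}) ℤ :=
    (gB G r).submatrix (splitEq i hi) (splitU v')
  have B11 : ∀ j, sE B j = inc (i j : Sym2 V) v := fun j => by simp [sE, B, gB, v']
  have B12 : ∀ j, B (.inl j) (.inr w') = inc (i j : Sym2 V) w := fun j => by simp [B, gB, w']
  have B21 : ∀ e, B (.inr e) (.inl ()) = inc (e.1 : Sym2 V) v := fun e => by simp [B, gB, v']
  have B22 : ∀ e, sB B e w' = inc (e.1 : Sym2 V) w := fun e => by simp [sB, B, gB, w']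
  have hvi : ∀ j, v ∈ (i j : Sym2 V) := fun j => (hir _).mp ⟨j, rfl⟩
  have hsw : ∀ j, sw B j (.inr w') = inc (i j : Sym2 V) v * inc (i j : Sym2 V) w
      - inc (i 0 : Sym2 V) v * inc (i 0 : Sym2 V) w := by
    intro j
    simp [sw, sW, B11, B12]
  have hVC : VC B := by
    refine ⟨w', ?_⟩
    have hcardF : ∀ n, ((Finset.univ.filter (fun e : ↥G.edgeFinset => w ∈ (e : Sym2 V))).filter
        (fun e => e ∉ Set.range i)).card = n →
        ∃ k : Fin n → {e : ↥G.edgeFinset // e ∉ Set.range i}, Function.Injective k ∧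
          (∀ l, sB B (k l) w' * sB B (k l) w' = 1) ∧ (∀ e, e ∉ Set.range k → sB B e w' = 0) := by
      intro n hn
      have hn' : (Finset.univ.filter (fun e : {e : ↥G.edgeFinset // e ∉ Set.range i} =>
          w ∈ (e.1 : Sym2 V))).card = n := by
        rw [← hn, ← Finset.card_map (Function.Embedding.subtype _)]
        congr 1
        ext e
        simp only [Finset.mem_map, Finset.mem_filter, Finset.mem_univ, true_and]
        constructor
        · rintro ⟨f, hf, rfl⟩; exact ⟨hf, f.2⟩
        · rintro ⟨h1, h2⟩; exact ⟨⟨e, h2⟩, h1, rfl⟩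
      obtain ⟨k, hk, hkr⟩ := enum_fin n _ hn'
      refine ⟨k, hk, fun l => ?_, fun e he => ?_⟩
      · have := (hkr (k l)).mp ⟨l, rfl⟩
        rw [B22]
        exact inc_mem _ _ (by simpa using this) (hdiag _)
      · rw [hkr] at he
        rw [B22]
        exact inc_not_mem _ _ (by simpa using he)
    by_cases h0 : w ∈ (i 0 : Sym2 V)
    · right
      obtain ⟨k, hk1, hk2, hk3⟩ := hcardF 2 (by
        have : ((Finset.univ.filter (fun e : ↥G.edgeFinset => w ∈ (e : Sym2 V))).filter
          (fun e => e ∉ Set.range i)) = (Finset.univ.filter (fun e : ↥G.edgeFinset => w ∈ (e : Sym2 V))).erase (i 0) := by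
          ext e
          simp only [Finset.mem_filter, Finset.mem_erase, Finset.mem_univ, true_and]
          constructor
          · rintro ⟨h1, h2⟩; exact ⟨fun h => h2 ⟨0, h.symm⟩, h1⟩
          · rintro ⟨h1, h2⟩
            refine ⟨h2, ?_⟩
            rintro ⟨j, rfl⟩
            by_cases hj : j = 0
            · exact h1 (by rw [hj])
            · exact hij j hj h2
        rw [this, Finset.card_erase_of_mem (by simpa using h0), card_star, hdw])
      refine ⟨k, hk1, hk2, hk3, fun j hj => ?_⟩
      rw [hsw, inc_not_mem _ w (hij j hj)]
      have e1 := inc_mem _ _ (hvi 0) (hdiag _)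
      have e2 := inc_mem _ _ h0 (hdiag _)
      linear_combination (inc (i 0 : Sym2 V) v * inc (i 0 : Sym2 V) v) * e2 + e1
    · left
      obtain ⟨k, hk1, hk2, hk3⟩ := hcardF 3 (by
        rw [Finset.filter_true_of_mem, card_star, hdw]
        rintro e he ⟨j, rfl⟩
        have he : w ∈ (i j : Sym2 V) := by simpa using he
        by_cases hj : j = 0
        · exact h0 (hj ▸ he)
        · exact hij j hj he)
      refine ⟨k, hk1, hk2, hk3, fun j hj => ?_⟩
      rw [hsw, inc_not_mem _ w (hij j hj), inc_not_mem _ w h0]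
      simp
  have hcU : Fintype.card {u : {u : V // u ≠ r} // u ∉ Set.range (fun _ : Unit => v')} + 2 = Fintype.card V := by
    have h1 := Fintype.card_congr (splitU v')
    rw [Fintype.card_sum, Fintype.card_unit, Fintype.card_subtype_compl (fun x : V => x = r), Fintype.card_subtype_eq] at h1
    omega
  have hcE : Fintype.card {e : ↥G.edgeFinset // e ∉ Set.range i} + 3 = G.edgeFinset.card := by
    have h1 := Fintype.card_congr (splitEq i hi)
    rw [Fintype.card_sum, Fintype.card_fin, Fintype.card_coe] at h1
    omega
  refine ⟨topc p B, fun s hs => ?_⟩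
  have : Fintype (GaloisField p s) := Fintype.ofFinite _
  have hK : Fintype.card (GaloisField p s) = p ^ s := by
    rw [← Nat.card_eq_fintype_card, GaloisField.card p s (by omega)]
  obtain ⟨c, hc1, hc2⟩ := core p s hs hK B
    (fun e => by rw [B21]; exact inc_not_mem _ _ (fun h => e.2 ((hir _).mpr h)))
    (fun j => by rw [B11]; exact inc_mem _ _ (hvi j) (hdiag _)) (by omega) (by omega) hVC
  refine ⟨c, ?_, hc2⟩
  rw [← hc1, pointCount, ← cnt_card]
  rw [show B.map (Int.castRingHom (GaloisField p s)) =
    ((gB G r).map (Int.castRingHom (GaloisField p s))).submatrix (splitEq i hi) (splitU v') from rfl,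
    cnt_bmat_reindex]
  exact cnt_congr fun x => kirchhoff_zero G r x

end assembly

/-- For a primitive divergent graph `G`, a prime `p`, `s ≥ 1` and
`q = p^s`, with `p² ∣ [Ψ_G]_p` and `q² ∣ [Ψ_G]_q`, we have
`c₂^{(q)}(G) ≡ (−1)^{s+1} (c₂^{(p)}(G))^s (mod p)`. -/
theorem statement0 {V : Type} [Fintype V] [DecidableEq V]
    (G : SimpleGraph V) [DecidableRel G.Adj]
    (hG : IsPrimitiveDivergent G)
    (p s : ℕ) [Fact p.Prime] (hs : 1 ≤ s)
    (hdivp : p ^ 2 ∣ pointCount p 1 (kirchhoff G))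
    (hdivq : (p ^ s) ^ 2 ∣ pointCount p s (kirchhoff G)) :
    ((pointCount p s (kirchhoff G) / (p ^ s) ^ 2 : ℕ) : ZMod p)
      = (-1) ^ (s + 1) * ((pointCount p 1 (kirchhoff G) / p ^ 2 : ℕ) : ZMod p) ^ s := by
  obtain ⟨a, ha⟩ := main_a G hG p
  have hp : 0 < p := (Fact.out : p.Prime).pos
  have key : ∀ t, 1 ≤ t → ((pointCount p t (kirchhoff G) / (p ^ t) ^ 2 : ℕ) : ZMod p) = - a ^ t := by
    intro t ht
    obtain ⟨c, hc1, hc2⟩ := ha t ht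
    rw [← hc2]
    have hne : (((p : ℤ) ^ t) ^ 2) ≠ 0 := by positivity
    have : ((pointCount p t (kirchhoff G) / (p ^ t) ^ 2 : ℕ) : ℤ) = c := by
      push_cast
      rw [hc1, Int.mul_ediv_cancel_left _ hne]
    rw [← this, Int.cast_natCast]
  have k1 := key 1 le_rfl
  rw [pow_one, pow_one] at k1
  rw [key s hs, k1, neg_pow a s, ← mul_assoc, ← pow_add]
  have : (-1 : ZMod p) ^ (s + 1 + s) = -1 := Odd.neg_one_pow ⟨s, by ring⟩
  rw [this]; ring
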